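/- Let G be a finite abelian group and let A = M_{x_0} \otimes \bigotimes_{i=1}^\infty M_{a_i} and A' = M_{x'_0} \otimes \bigotimes_{i=1}^\infty M_{a'_i} be direct limits of elementarily G-graded matrix algebras in standard form with supports S and S'. Then A \cong A' as G-graded algebras if and only if S = S' and there exist b, b' in Z_{\geq 0}G with supp(b) = supp(b') = S such that b \bar{x}_0 = b' \bar{x}'_0 and b K^+(A) = b' K^+(A'). -/

import Mathlib

noncomputable section

open scoped TensorProduct

/-- A `G`-grading on the `F`-algebra `A`: the components multiply according to the group law,
`1` is homogeneous of trivial degree, and `A` is the internal direct sum of the components. -/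
def IsGrading (F : Type) [Field F] {G : Type} [CommGroup G] [DecidableEq G]
    {A : Type} [Ring A] [Algebra F A] (𝒜 : G → Submodule F A) : Prop :=
  (1 : A) ∈ 𝒜 1 ∧
  (∀ {g h : G} {a b : A}, a ∈ 𝒜 g → b ∈ 𝒜 h → a * b ∈ 𝒜 (g * h)) ∧
  DirectSum.IsInternal 𝒜

/-- Isomorphism of `G`-graded algebras: an algebra isomorphism matching up the
homogeneous components. -/
def IsGradedAlgIso (F : Type) [Field F] {G : Type} [CommGroup G]
    {A B : Type} [Ring A] [Algebra F A] [Ring B] [Algebra F B]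
    (𝒜 : G → Submodule F A) (ℬ : G → Submodule F B) : Prop :=
  ∃ e : A ≃ₐ[F] B, ∀ g, (𝒜 g).map e.toLinearMap = ℬ g

/-- A homomorphism of graded algebras: it maps each component into the corresponding one. -/
def IsGradedHom (F : Type) [Field F] {G : Type} [CommGroup G]
    {A B : Type} [Ring A] [Algebra F A] [Ring B] [Algebra F B]
    (𝒜 : G → Submodule F A) (ℬ : G → Submodule F B) (f : A →ₐ[F] B) : Prop :=
  ∀ g, (𝒜 g).map f.toLinearMap ≤ ℬ g

/-- The `G`-grading on the matrix algebra `M_ι(A)` induced by a tuple `γ : ι → G` and the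
grading `𝒜` of `A`: `deg (E i j a) = γ i * deg a * (γ j)⁻¹`. -/
def matrixGrading {F : Type} [Field F] {G : Type} [CommGroup G]
    {A : Type} [Ring A] [Algebra F A] {ι : Type} (γ : ι → G)
    (𝒜 : G → Submodule F A) (g : G) : Submodule F (Matrix ι ι A) where
  carrier := {M | ∀ i j, M i j ∈ 𝒜 ((γ i)⁻¹ * g * γ j)}
  add_mem' := fun hM hN i j => add_mem (hM i j) (hN i j)
  zero_mem' := fun i j => zero_mem _
  smul_mem' := fun c M hM i j => Submodule.smul_mem _ c (hM i j)

/-- The trivial grading on the base field. -/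
def trivGrading (F : Type) [Field F] (G : Type) [CommGroup G] [DecidableEq G]
    (g : G) : Submodule F F :=
  if g = 1 then ⊤ else ⊥

/-- The elementary grading on a matrix algebra over `F` determined by the tuple `γ`. -/
def elemGrading {F : Type} [Field F] {G : Type} [CommGroup G] [DecidableEq G]
    {ι : Type} (γ : ι → G) : G → Submodule F (Matrix ι ι F) :=
  matrixGrading γ (trivGrading F G)

/-- `γ` is a tuple representing the multiset `x` of elements of `G`. -/
def Reps {G : Type} [CommGroup G] {n : ℕ} (γ : Fin n → G) (x : Multiset G) : Prop :=
  Multiset.map γ Finset.univ.val = x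

/-- Product of multisets of group elements, corresponding to the product in the
group semiring `ℤ≥0 G`. -/
def mmul {G : Type} [CommGroup G] (x y : Multiset G) : Multiset G :=
  x.bind fun g => y.map (g * ·)

/-- The image of a multiset under `g ↦ g⁻¹`, corresponding to the bar involution of `ℤG`. -/
def mbarM {G : Type} [CommGroup G] (x : Multiset G) : Multiset G :=
  x.map fun g => g⁻¹

/-- The grading of a tensor product of graded algebras: `deg (a ⊗ b) = deg a * deg b`. -/
def tensorGrading (F : Type) [Field F] {G : Type} [CommGroup G]
    {A B : Type} [Ring A] [Algebra F A] [Ring B] [Algebra F B]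
    (𝒜 : G → Submodule F A) (ℬ : G → Submodule F B) (g : G) : Submodule F (A ⊗[F] B) :=
  ⨆ p : {p : G × G // p.1 * p.2 = g},
    Submodule.map₂ (TensorProduct.mk F A B) (𝒜 p.1.1) (ℬ p.1.2)

/-- The grading induced on a subalgebra (e.g. a centralizer) of a graded algebra. -/
def subGrading {F : Type} [Field F] {G : Type} [CommGroup G]
    {B : Type} [Ring B] [Algebra F B] (C : Subalgebra F B)
    (ℬ : G → Submodule F B) (g : G) : Submodule F C :=
  (ℬ g).comap C.val.toLinearMap

/-- The grading on the opposite algebra, with the same homogeneous components. -/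
def opGrading {F : Type} [Field F] {G : Type} [CommGroup G]
    {A : Type} [Ring A] [Algebra F A] (𝒜 : G → Submodule F A) (g : G) : Submodule F Aᵐᵒᵖ :=
  (𝒜 g).map (MulOpposite.opLinearEquiv F).toLinearMap

/-- The grading on `End_F(A)` induced by a grading of `A`: a map is homogeneous of degree `g`
if it maps `A_h` into `A_{g h}` for all `h`. -/
def endGrading {F : Type} [Field F] {G : Type} [CommGroup G]
    {A : Type} [Ring A] [Algebra F A] (𝒜 : G → Submodule F A) (g : G) :
    Submodule F (Module.End F A) where
  carrier := {f | ∀ h : G, ∀ a ∈ 𝒜 h, f a ∈ 𝒜 (g * h)}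
  add_mem' := fun hf hf' h a ha => add_mem (hf h a ha) (hf' h a ha)
  zero_mem' := fun _ _ _ => zero_mem _
  smul_mem' := fun c f hf h a ha => Submodule.smul_mem _ c (hf h a ha)
/-- Evaluation of a complex character of `G` on a multiset (an element of `ℤ≥0 G`). -/
def evChar {G : Type} [CommGroup G] (χ : G →* ℂˣ) (x : Multiset G) : ℂ :=
  (x.map fun g => (χ g : ℂ)).sum

/-- The support of an element of `ℤ≥0 G ⊆ ℚG`, recorded as the (Galois-stable) set of
characters not vanishing on it; it corresponds to the set of Wedderburn components of `ℚG`
on which the element has nonzero projection. -/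
def suppM {G : Type} [CommGroup G] (x : Multiset G) : Set (G →* ℂˣ) :=
  {χ | evChar χ x ≠ 0}
open Classical

/-- `b i = \bar a 1 ⋯ \bar a i`: the product of the bars of the labels. -/
def bprod {G : Type} [CommGroup G] (a : ℕ → Multiset G) : ℕ → Multiset G
  | 0 => {1}
  | i + 1 => mmul (bprod a i) (mbarM (a i))

/-- The explicit realization, inside the Wedderburn components indexed by the characters
in `S`, of the positive cone `K⁺ = ⋃_i (1/π_S(b i)) π_S(ℤ≥0 G)` of the graded Grothendieck
group of the limit `M_{x 0} ⊗ ⊗_i M_{a i}`. Functions vanish outside `S`. -/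
def Kplus {G : Type} [CommGroup G] (S : Set (G →* ℂˣ)) (a : ℕ → Multiset G) :
    Set ((G →* ℂˣ) → ℂ) :=
  {f | ∃ (i : ℕ) (c : Multiset G), ∀ χ : G →* ℂˣ,
    f χ = if χ ∈ S then evChar χ c / evChar χ (bprod a i) else 0}

/-- The projection `π_S` of an element of `ℤ≥0 G ⊆ ℚG` to the components indexed by `S`. -/
def piS {G : Type} [CommGroup G] (S : Set (G →* ℂˣ)) (x : Multiset G) : (G →* ℂˣ) → ℂ :=
  fun χ => if χ ∈ S then evChar χ x else 0

/-- Multiplication of a subset of `L_S` by (the projection of) an element of `ℤ≥0 G`. -/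
def mscale {G : Type} [CommGroup G] (b : Multiset G) (K : Set ((G →* ℂˣ) → ℂ)) :
    Set ((G →* ℂˣ) → ℂ) :=
  (fun f χ => evChar χ b * f χ) '' K
/-- `(L, ℒ)` is a direct limit of the chain of unital graded embeddings
`ι i : A i → A (i+1)`: there are compatible injective unital graded homomorphisms
`φ i : A i → L` whose images exhaust `L` as well as each homogeneous component of `L`. -/
def IsGradedDirectLimit (F : Type) [Field F] {G : Type} [CommGroup G]
    (A : ℕ → Type) [∀ i, Ring (A i)] [∀ i, Algebra F (A i)]
    (𝒜 : ∀ i, G → Submodule F (A i)) (ι : ∀ i, A i →ₐ[F] A (i + 1))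
    {L : Type} [Ring L] [Algebra F L] (ℒ : G → Submodule F L) : Prop :=
  ∃ φ : ∀ i, A i →ₐ[F] L,
    (∀ i, Function.Injective (φ i)) ∧
    (∀ i, (φ (i + 1)).comp (ι i) = φ i) ∧
    (∀ z : L, ∃ i, z ∈ (φ i).range) ∧
    (∀ g, (ℒ g : Set L) = ⋃ i, (φ i) '' (𝒜 i g))
/-- The unital embedding `ι : M_γ(F) → M_δ(F)` of elementarily graded matrix algebras has
label `η`: the centralizer of its image, with the induced grading, is graded-isomorphic to
the matrix algebra with elementary grading `η`. -/
def HasLabel {F : Type} [Field F] {G : Type} [CommGroup G] [DecidableEq G]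
    {n m k : ℕ} (γ : Fin n → G) (δ : Fin m → G) (η : Fin k → G)
    (ι : Matrix (Fin n) (Fin n) F →ₐ[F] Matrix (Fin m) (Fin m) F) : Prop :=
  IsGradedHom F (elemGrading γ) (elemGrading δ) ι ∧
  IsGradedAlgIso F
    (subGrading (Subalgebra.centralizer F (Set.range ι)) (elemGrading δ))
    (elemGrading η)

/-- `(L, ℒ)` is the direct limit `M_{x 0} ⊗ ⊗_{i} M_{a i}` of matrix algebras with elementary
`G`-gradings: the `i`-th algebra is `M_{x i}(F)` and the `i`-th unital graded embedding
has label `a i`, so that `x (i+1) = x i * a i`. -/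
def IsElemLimit (F : Type) [Field F] {G : Type} [CommGroup G] [DecidableEq G]
    (L : Type) [Ring L] [Algebra F L] (ℒ : G → Submodule F L)
    (x a : ℕ → Multiset G) : Prop :=
  (∀ i, x (i + 1) = mmul (x i) (a i)) ∧
  ∃ (n : ℕ → ℕ) (γ : ∀ i, Fin (n i) → G) (k : ℕ → ℕ) (η : ∀ i, Fin (k i) → G)
    (ι : ∀ i, Matrix (Fin (n i)) (Fin (n i)) F →ₐ[F]
      Matrix (Fin (n (i + 1))) (Fin (n (i + 1))) F),
    (∀ i, Reps (γ i) (x i)) ∧ (∀ i, Reps (η i) (a i)) ∧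
    (∀ i, Function.Injective (ι i)) ∧
    (∀ i, HasLabel (γ i) (γ (i + 1)) (η i) (ι i)) ∧
    IsGradedDirectLimit F _ (fun i => elemGrading (γ i)) ι ℒ

/-- `(L, ℒ)` is a direct limit of matrix algebras over `F` endowed with (arbitrary)
`G`-gradings, along unital graded embeddings. -/
def IsMatrixLimit (F : Type) [Field F] {G : Type} [CommGroup G] [DecidableEq G]
    (L : Type) [Ring L] [Algebra F L] (ℒ : G → Submodule F L) : Prop :=
  ∃ (n : ℕ → ℕ) (Mg : ∀ i, G → Submodule F (Matrix (Fin (n i)) (Fin (n i)) F))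
    (ι : ∀ i, Matrix (Fin (n i)) (Fin (n i)) F →ₐ[F]
      Matrix (Fin (n (i + 1))) (Fin (n (i + 1))) F),
    (∀ i, IsGrading F (Mg i)) ∧
    (∀ i, IsGradedHom F (Mg i) (Mg (i + 1)) (ι i)) ∧
    IsGradedDirectLimit F _ Mg ι ℒ

/-- `(L, ℒ)` is a direct limit of matrix algebras over `F` endowed with elementary
`G`-gradings, along unital graded embeddings. -/
def IsElemMatrixLimit (F : Type) [Field F] {G : Type} [CommGroup G] [DecidableEq G]
    (L : Type) [Ring L] [Algebra F L] (ℒ : G → Submodule F L) : Prop :=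
  ∃ (n : ℕ → ℕ) (γ : ∀ i, Fin (n i) → G)
    (ι : ∀ i, Matrix (Fin (n i)) (Fin (n i)) F →ₐ[F]
      Matrix (Fin (n (i + 1))) (Fin (n (i + 1))) F),
    (∀ i, Function.Injective (ι i)) ∧
    (∀ i, IsGradedHom F (elemGrading (γ i)) (elemGrading (γ (i + 1))) (ι i)) ∧
    IsGradedDirectLimit F _ (fun i => elemGrading (γ i)) ι ℒ

section Characters

variable {G : Type} [CommGroup G]

lemma evChar_one_singleton (χ : G →* ℂˣ) : evChar χ ({1} : Multiset G) = 1 := by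
  simp [evChar]

lemma evChar_singleton (χ : G →* ℂˣ) (g : G) : evChar χ ({g} : Multiset G) = χ g := by
  simp [evChar]

lemma evChar_add (χ : G →* ℂˣ) (x y : Multiset G) :
    evChar χ (x + y) = evChar χ x + evChar χ y := by
  simp [evChar]

lemma evChar_mmul (χ : G →* ℂˣ) (x y : Multiset G) :
    evChar χ (mmul x y) = evChar χ x * evChar χ y := by
  induction x using Multiset.induction_on with
  | empty => simp [mmul, evChar]
  | cons g x ih =>
    have h : mmul (g ::ₘ x) y = y.map (g * ·) + mmul x y := by simp [mmul]
    have h' : evChar χ (y.map (g * ·)) = χ g * evChar χ y := by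
      simp [evChar, Multiset.sum_map_mul_left]
    have h'' : evChar χ (g ::ₘ x) = χ g + evChar χ x := by simp [evChar]
    rw [h, evChar_add, ih, h', h'', add_mul]

lemma evChar_mbarM (χ : G →* ℂˣ) (x : Multiset G) :
    evChar χ (mbarM x) = evChar χ⁻¹ x := by
  simp [evChar, mbarM]

lemma evChar_one (x : Multiset G) : evChar 1 x = Multiset.card x := by
  simp [evChar]

lemma evChar_univ_map {κ : Type} [Fintype κ] (χ : G →* ℂˣ) (η : κ → G) :
    evChar χ (Finset.univ.val.map η) = ∑ k, (χ (η k) : ℂ) := by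
  simp only [evChar, Multiset.map_map]
  rfl

lemma mbarM_mbarM (x : Multiset G) : mbarM (mbarM x) = x := by
  simp [mbarM]

lemma suppM_eq_empty {x : Multiset G} (h : suppM x = ∅) : x = 0 := by
  have : (1 : G →* ℂˣ) ∉ suppM x := by simp [h]
  simpa [suppM, evChar_one] using this

lemma evChar_bprod (χ : G →* ℂˣ) (a : ℕ → Multiset G) (i : ℕ) :
    evChar χ (bprod a i) = ∏ l ∈ Finset.range i, evChar χ (mbarM (a l)) := by
  induction i with
  | zero => simp [bprod, evChar_one_singleton]
  | succ i ih => rw [bprod, evChar_mmul, ih, Finset.prod_range_succ]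

variable [Fintype G]

lemma evChar_inv (χ : G →* ℂˣ) (x : Multiset G) :
    evChar χ⁻¹ x = starRingEnd ℂ (evChar χ x) := by
  simp only [evChar, map_multiset_sum, Multiset.map_map, Function.comp_def]
  congr 1
  refine Multiset.map_congr rfl fun g _ => ?_
  have h : ‖(χ g : ℂ)‖ = 1 := by
    refine Complex.norm_eq_one_of_pow_eq_one (n := Fintype.card G) ?_ Fintype.card_ne_zero
    rw [← Units.val_pow_eq_pow_val, ← map_pow, pow_card_eq_one]
    simp
  rw [MonoidHom.inv_apply, Units.val_inv_eq_inv_val, Complex.inv_def, Complex.normSq_eq_norm_sq, h]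
  simp

lemma evChar_mbarM_ne_zero_iff (χ : G →* ℂˣ) (x : Multiset G) :
    evChar χ (mbarM x) ≠ 0 ↔ χ ∈ suppM x := by
  rw [evChar_mbarM, evChar_inv]
  simp [suppM]

lemma exists_char_ne_one {g : G} (hg : g ≠ 1) : ∃ χ : G →* ℂˣ, χ g ≠ 1 := by
  have : NeZero ((Monoid.exponent G : ℕ) : ℂ) :=
    ⟨by exact_mod_cast Monoid.exponent_ne_zero_of_finite⟩
  exact CommGroup.exists_apply_ne_one_of_hasEnoughRootsOfUnity G ℂ hg

lemma multiset_eq_of_evChar_eq {x y : Multiset G} (h : ∀ χ : G →* ℂˣ, evChar χ x = evChar χ y) :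
    x = y := by
  have hfin : Finite (G →* ℂˣ) := by
    have : NeZero ((Monoid.exponent G : ℕ) : ℂ) :=
      ⟨by exact_mod_cast Monoid.exponent_ne_zero_of_finite⟩
    exact Finite.of_equiv G (CommGroup.monoidHom_mulEquiv_of_hasEnoughRootsOfUnity G ℂ).some.symm.toEquiv
  have := Fintype.ofFinite (G →* ℂˣ)
  have orth : ∀ g : G, (∑ χ : G →* ℂˣ, (χ g : ℂ)) =
      if g = 1 then (Fintype.card (G →* ℂˣ) : ℂ) else 0 := by
    intro g
    split_ifs with hg
    · simp [hg]
    · obtain ⟨ψ, hψ⟩ := exists_char_ne_one hg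
      have h1 : (ψ g : ℂ) * ∑ χ : G →* ℂˣ, (χ g : ℂ) = ∑ χ : G →* ℂˣ, (χ g : ℂ) := by
        rw [Finset.mul_sum]
        exact Fintype.sum_equiv (Equiv.mulLeft ψ) _ _ fun χ => by simp
      have h2 : ((ψ g : ℂ) - 1) * ∑ χ : G →* ℂˣ, (χ g : ℂ) = 0 := by
        rw [sub_mul, h1, one_mul, sub_self]
      refine (mul_eq_zero.mp h2).resolve_left fun h3 => hψ ?_
      exact Units.ext (by simpa using sub_eq_zero.mp h3)
  have key : ∀ (z : Multiset G) (g : G),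
      ∑ χ : G →* ℂˣ, (χ g⁻¹ : ℂ) * evChar χ z = Fintype.card (G →* ℂˣ) * (z.count g : ℂ) := by
    intro z g
    induction z using Multiset.induction_on with
    | empty => simp [evChar]
    | cons a z ih =>
      have h' : ∀ χ : G →* ℂˣ, evChar χ (a ::ₘ z) = χ a + evChar χ z := by simp [evChar]
      have h2 := orth (g⁻¹ * a)
      simp only [map_mul, Units.val_mul] at h2
      simp only [h', mul_add, Finset.sum_add_distrib, ih, h2, Multiset.count_cons,
        inv_mul_eq_one]
      split_ifs <;> push_cast <;> ring
  ext g
  have h1 := key x g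
  simp only [h, key y g] at h1
  have h0 : (Fintype.card (G →* ℂˣ) : ℂ) ≠ 0 := by simp
  exact_mod_cast (mul_left_cancel₀ h0 h1).symm

lemma mmul_one_right (x : Multiset G) : mmul x {1} = x :=
  multiset_eq_of_evChar_eq fun χ => by simp [evChar_mmul, evChar_one_singleton]

lemma mmul_univ_map {n κ : Type} [Fintype n] [Fintype κ] (γ : n → G) (η : κ → G) :
    mmul (Finset.univ.val.map γ) (Finset.univ.val.map η) =
      Finset.univ.val.map (fun q : n × κ => γ q.1 * η q.2) :=
  multiset_eq_of_evChar_eq fun χ => by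
    simp [evChar_mmul, evChar_univ_map, Fintype.sum_prod_type, Finset.sum_mul_sum]

end Characters

open scoped Kronecker

section Homogeneous

variable {F : Type} [Field F] {G : Type}
  {m n r : Type} [Fintype m] [Fintype n] [Fintype r] [DecidableEq m] [DecidableEq n] [DecidableEq r]

/-- A rectangular matrix that preserves degrees, when its rows have degrees `δ` and its columns
have degrees `ε`. -/
def IsHomog (δ : m → G) (ε : n → G) (U : Matrix m n F) : Prop :=
  ∀ p q, U p q ≠ 0 → δ p = ε q

omit [Fintype m] [Fintype r] [DecidableEq m] [DecidableEq n] [DecidableEq r] in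
lemma IsHomog.mul {δ : m → G} {ε : n → G} {ζ : r → G} {U : Matrix m n F} {V : Matrix n r F}
    (hU : IsHomog δ ε U) (hV : IsHomog ε ζ V) : IsHomog δ ζ (U * V) := by
  intro p q h
  obtain ⟨s, -, hs⟩ := Finset.exists_ne_zero_of_sum_ne_zero (by simpa [Matrix.mul_apply] using h)
  exact (hU p s (left_ne_zero_of_mul hs)).trans (hV s q (right_ne_zero_of_mul hs))

lemma IsHomog.map_eq {δ : m → G} {ε : n → G} {U : Matrix m n F} {V : Matrix n m F}
    (hU : IsHomog δ ε U) (hV : IsHomog ε δ V) (h : U * V = 1) (h' : V * U = 1) :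
    Finset.univ.val.map δ = Finset.univ.val.map ε := by
  ext g
  have aux : ∀ {a b : Type} [Fintype a] [Fintype b] [DecidableEq a] [DecidableEq b]
      {δ : a → G} {ε : b → G} {U : Matrix a b F} {V : Matrix b a F},
      IsHomog δ ε U → U * V = 1 →
      U.submatrix (Subtype.val : {p // δ p = g} → a) (Subtype.val : {q // ε q = g} → b) *
        V.submatrix (Subtype.val : {q // ε q = g} → b) (Subtype.val : {p // δ p = g} → a) = 1 := by
    intro a b _ _ _ _ δ ε U V hU h
    ext ⟨i, hi⟩ ⟨j, hj⟩
    have h1 := congrFun (congrFun h i) j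
    rw [Matrix.mul_apply] at h1 ⊢
    have h2 : ∑ q : {q // ε q = g}, U i q * V q j = ∑ q, U i q * V q j := by
      rw [← Finset.sum_subtype (Finset.univ.filter fun q => ε q = g) (by simp)
        (fun q => U i q * V q j)]
      refine Finset.sum_subset (Finset.subset_univ _) fun q _ hq => ?_
      by_cases hz : U i q = 0
      · simp [hz]
      · exact absurd ((hU i q hz).symm.trans hi) (by simpa using hq)
    simp only [Matrix.submatrix_apply]
    rw [h2, h1]
    simp [Matrix.one_apply]
  have e := Matrix.toLin'OfInv (aux hV h') (aux hU h)
  have e' := e.finrank_eq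
  simp only [Module.finrank_fintype_fun_eq_card] at e'
  simp only [Multiset.count_map]
  rw [Fintype.card_subtype, Fintype.card_subtype] at e'
  simpa [Finset.card, Finset.filter_val, eq_comm] using e'

omit [DecidableEq m] [DecidableEq n] in
lemma exists_equiv_of_map_eq {δ : m → G} {ε : n → G}
    (h : Finset.univ.val.map δ = Finset.univ.val.map ε) : ∃ σ : n ≃ m, ∀ q, δ (σ q) = ε q := by
  have h1 : ∀ g, Fintype.card {q // ε q = g} = Fintype.card {p // δ p = g} := by
    intro g
    have := congrArg (Multiset.count g) h
    simp only [Multiset.count_map] at this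
    rw [Fintype.card_subtype, Fintype.card_subtype]
    simpa [Finset.card, Finset.filter_val, eq_comm] using this.symm
  exact ⟨Equiv.ofFiberEquiv fun g => Fintype.equivOfCardEq (h1 g),
    fun q => Equiv.ofFiberEquiv_map _ q⟩

omit [Fintype m] [Fintype n] [DecidableEq n] in
lemma isHomog_perm {δ : m → G} {ε : n → G} (σ : n ≃ m) (hσ : ∀ q, δ (σ q) = ε q) :
    IsHomog δ ε ((1 : Matrix m m F).submatrix id σ) := by
  intro p q h
  have : p = σ q := by
    by_contra hne
    exact h (by simp [hne])
  rw [this, hσ]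

omit [Fintype m] [Fintype n] [DecidableEq n] in
lemma isHomog_perm' {δ : m → G} {ε : n → G} (σ : n ≃ m) (hσ : ∀ q, δ (σ q) = ε q) :
    IsHomog ε δ ((1 : Matrix m m F).submatrix σ id) := by
  intro p q h
  have : q = σ p := by
    by_contra hne
    exact h (by simp [Ne.symm hne])
  rw [this, hσ]

omit [DecidableEq n] in
lemma perm_mul_perm (σ : n ≃ m) :
    (1 : Matrix m m F).submatrix id σ * (1 : Matrix m m F).submatrix σ id = 1 := by
  rw [Matrix.submatrix_mul_equiv]; simp

omit [Fintype n] in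
lemma perm_mul_perm' (σ : n ≃ m) :
    (1 : Matrix m m F).submatrix σ id * (1 : Matrix m m F).submatrix id σ = 1 := by
  have := Matrix.submatrix_mul_equiv (1 : Matrix m m F) (1 : Matrix m m F) σ (Equiv.refl m) σ
  simp only [Equiv.coe_refl] at this
  rw [this]; simp

end Homogeneous

section Kronecker

variable {F : Type} [Field F]
  {n κ κ' : Type} [Fintype n] [Fintype κ] [Fintype κ'] [DecidableEq n] [DecidableEq κ]
  [DecidableEq κ']

lemma eq_one_kronecker_of_commute {W : Matrix (n × κ) (n × κ') F}
    (hW : ∀ X : Matrix n n F, W * (X ⊗ₖ (1 : Matrix κ' κ' F)) = (X ⊗ₖ (1 : Matrix κ κ F)) * W)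
    (q₀ : n) : W = (1 : Matrix n n F) ⊗ₖ Matrix.of (fun k k' => W (q₀, k) (q₀, k')) := by
  have h1 : ∀ (a b r s : n) (k : κ) (k' : κ'),
      (if b = s then W (r, k) (a, k') else 0) = if a = r then W (b, k) (s, k') else 0 := by
    intro a b r s k k'
    have := congrFun (congrFun (hW (Matrix.single a b 1)) (r, k)) (s, k')
    simpa [Matrix.mul_apply, Matrix.kroneckerMap_apply, Fintype.sum_prod_type, Matrix.single_apply,
      Matrix.one_apply, ite_and, Finset.sum_ite_eq, Finset.sum_ite_eq'] using this
  ext ⟨q, k⟩ ⟨q', k'⟩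
  simp only [Matrix.kroneckerMap_apply, Matrix.one_apply, Matrix.of_apply, ite_mul, one_mul,
    zero_mul]
  split_ifs with h
  · subst h
    simpa using h1 q q₀ q q₀ k k'
  · simpa [Ne.symm h] using h1 q' q' q q' k k'

end Kronecker

section Multiplicity

variable {F : Type} [Field F] {G : Type} [CommGroup G]
  {m n r κ : Type} [Fintype m] [Fintype n] [Fintype r] [Fintype κ]
  [DecidableEq m] [DecidableEq n] [DecidableEq r] [DecidableEq κ]

/-- The conjugation `W ↦ U W V` by an invertible rectangular matrix. -/
def conjHom (U : Matrix m n F) (V : Matrix n m F) (h : U * V = 1) (h' : V * U = 1) :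
    Matrix n n F →ₐ[F] Matrix m m F :=
  AlgHom.ofLinearMap
    { toFun := fun W => U * W * V
      map_add' := fun W W' => by rw [Matrix.mul_add, Matrix.add_mul]
      map_smul' := fun c W => by simp }
    (by simpa using h)
    (fun W W' => by
      simp only [LinearMap.coe_mk, AddHom.coe_mk, Matrix.mul_assoc]
      rw [← Matrix.mul_assoc V U, h', Matrix.one_mul])

lemma conjHom_apply (U : Matrix m n F) (V : Matrix n m F) (h : U * V = 1) (h' : V * U = 1)
    (W : Matrix n n F) : conjHom U V h h' W = U * W * V := rfl

/-- The embedding `X ↦ X ⊗ 1`. -/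
def kronOneRight (F κ n : Type) [Field F] [Fintype n] [Fintype κ] [DecidableEq n] [DecidableEq κ] :
    Matrix n n F →ₐ[F] Matrix (n × κ) (n × κ) F :=
  AlgHom.ofLinearMap
    { toFun := fun X => X ⊗ₖ (1 : Matrix κ κ F)
      map_add' := fun X Y => Matrix.add_kronecker X Y 1
      map_smul' := fun c X => Matrix.smul_kronecker c X 1 }
    (by simp)
    (fun X Y => by
      simp only [LinearMap.coe_mk, AddHom.coe_mk]
      rw [← Matrix.mul_kronecker_mul, Matrix.one_mul])

/-- The embedding `Y ↦ 1 ⊗ Y`. -/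
def kronOneLeft (F κ n : Type) [Field F] [Fintype n] [Fintype κ] [DecidableEq n] [DecidableEq κ] :
    Matrix κ κ F →ₐ[F] Matrix (n × κ) (n × κ) F :=
  AlgHom.ofLinearMap
    { toFun := fun Y => (1 : Matrix n n F) ⊗ₖ Y
      map_add' := fun X Y => Matrix.kronecker_add 1 X Y
      map_smul' := fun c X => Matrix.kronecker_smul c 1 X }
    (by simp)
    (fun X Y => by
      simp only [LinearMap.coe_mk, AddHom.coe_mk]
      rw [← Matrix.mul_kronecker_mul, Matrix.one_mul])

/-- The unital homomorphism `φ : M_γ → M_δ` has multiplicity `c` if it is the standard embedding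
`X ↦ X ⊗ 1` into `M_γ ⊗ M_c`, up to a graded change of basis. -/
def HasMult (γ : n → G) (δ : m → G) (φ : Matrix n n F →ₐ[F] Matrix m m F) (c : Multiset G) :
    Prop :=
  ∃ (κ : Type) (_ : Fintype κ) (_ : DecidableEq κ) (η : κ → G)
    (U : Matrix m (n × κ) F) (V : Matrix (n × κ) m F),
    Finset.univ.val.map η = c ∧ U * V = 1 ∧ V * U = 1 ∧
    IsHomog δ (fun q : n × κ => γ q.1 * η q.2) U ∧
    IsHomog (fun q : n × κ => γ q.1 * η q.2) δ V ∧
    ∀ X, φ X = U * (X ⊗ₖ (1 : Matrix κ κ F)) * V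

lemma mem_trivGrading [DecidableEq G] {g : G} {a : F} :
    a ∈ trivGrading F G g ↔ (a ≠ 0 → g = 1) := by
  unfold trivGrading
  by_cases h : g = 1
  · rw [if_pos h]
    exact ⟨fun _ _ => h, fun _ => Submodule.mem_top⟩
  · rw [if_neg h, Submodule.mem_bot]
    exact ⟨fun ha ha' => absurd ha ha', fun ha => by_contra fun ha' => h (ha ha')⟩

omit [Fintype n] [DecidableEq n] in
lemma mem_elemGrading [DecidableEq G] {γ : n → G} {g : G} {X : Matrix n n F} :
    X ∈ elemGrading γ g ↔ ∀ i j, X i j ≠ 0 → γ i = g * γ j := by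
  change (∀ i j, X i j ∈ trivGrading F G ((γ i)⁻¹ * g * γ j)) ↔ _
  refine forall_congr' fun i => forall_congr' fun j => ?_
  rw [mem_trivGrading, mul_assoc, inv_mul_eq_one]

omit [Fintype n] [DecidableEq n] in
lemma mem_elemGrading_iff_isHomog [DecidableEq G] {γ : n → G} {g : G} {X : Matrix n n F} :
    X ∈ elemGrading γ g ↔ IsHomog γ (fun j => g * γ j) X :=
  mem_elemGrading

omit [Fintype m] [Fintype n] [DecidableEq m] [DecidableEq n] in
lemma IsHomog.const_mul {δ : m → G} {ε : n → G} {U : Matrix m n F} (hU : IsHomog δ ε U) (g : G) :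
    IsHomog (fun p => g * δ p) (fun q => g * ε q) U :=
  fun p q h => congrArg (g * ·) (hU p q h)

lemma HasMult.isGradedHom [DecidableEq G] {γ : n → G} {δ : m → G}
    {φ : Matrix n n F →ₐ[F] Matrix m m F} {c : Multiset G} (h : HasMult γ δ φ c) :
    IsGradedHom F (elemGrading γ) (elemGrading δ) φ := by
  obtain ⟨κ, _, _, η, U, V, -, -, -, hU, hV, hφ⟩ := h
  rintro g _ ⟨X, hX, rfl⟩
  rw [SetLike.mem_coe, mem_elemGrading] at hX
  rw [mem_elemGrading_iff_isHomog]
  change IsHomog _ _ (φ X)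
  rw [hφ]
  refine (hU.mul ?_).mul (hV.const_mul g)
  rintro ⟨i, k⟩ ⟨j, l⟩ hne
  rw [Matrix.kroneckerMap_apply, Matrix.one_apply] at hne
  have hkl : k = l := by
    by_contra hkl
    simp [hkl] at hne
  rw [if_pos hkl, mul_one] at hne
  simp [hkl, hX i j hne, mul_assoc]

lemma HasMult.eq_mmul [Fintype G] {γ : n → G} {δ : m → G}
    {φ : Matrix n n F →ₐ[F] Matrix m m F} {c : Multiset G} (h : HasMult γ δ φ c) :
    Finset.univ.val.map δ = mmul (Finset.univ.val.map γ) c := by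
  obtain ⟨κ, _, _, η, U, V, rfl, hUV, hVU, hU, hV, -⟩ := h
  rw [mmul_univ_map]
  exact hU.map_eq hV hUV hVU

lemma exists_hasMult [Fintype G] {γ : n → G} {δ : m → G} {c : Multiset G}
    (h : Finset.univ.val.map δ = mmul (Finset.univ.val.map γ) c) :
    ∃ φ : Matrix n n F →ₐ[F] Matrix m m F, HasMult γ δ φ c := by
  obtain ⟨l, rfl⟩ := Quot.exists_rep c
  have hl : Finset.univ.val.map l.get = (l : Multiset G) := by
    rw [Fin.univ_val_map, List.ofFn_get]
  change _ = mmul _ (l : Multiset G) at h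
  rw [← hl, mmul_univ_map] at h
  obtain ⟨σ, hσ⟩ := exists_equiv_of_map_eq h
  refine ⟨(conjHom _ _ (perm_mul_perm σ) (perm_mul_perm' σ)).comp (kronOneRight F _ n),
    Fin l.length, inferInstance, inferInstance, l.get, _, _, hl, perm_mul_perm σ, perm_mul_perm' σ,
    isHomog_perm σ hσ, isHomog_perm' σ hσ, fun X => rfl⟩

lemma HasMult.comp [Fintype G] {γ : n → G} {δ : m → G} {ε : r → G}
    {φ : Matrix n n F →ₐ[F] Matrix m m F} {ψ : Matrix m m F →ₐ[F] Matrix r r F}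
    {c d : Multiset G} (hψ : HasMult δ ε ψ d) (hφ : HasMult γ δ φ c) :
    HasMult γ ε (ψ.comp φ) (mmul c d) := by
  obtain ⟨κ, _, _, η, U, V, rfl, hUV, hVU, hU, hV, hφ⟩ := hφ
  obtain ⟨κ', _, _, η', U', V', rfl, hUV', hVU', hU', hV', hψ⟩ := hψ
  let σ := Equiv.prodAssoc n κ κ'
  have hUσ : IsHomog (fun q : m × κ' => δ q.1 * η' q.2)
      (fun q : n × (κ × κ') => γ q.1 * (η q.2.1 * η' q.2.2))
      ((U ⊗ₖ (1 : Matrix κ' κ' F)).submatrix id σ.symm) := by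
    rintro ⟨i, k⟩ ⟨j, l, l'⟩ hne
    simp only [Matrix.submatrix_apply, id, σ, Equiv.prodAssoc_symm_apply,
      Matrix.kroneckerMap_apply, Matrix.one_apply] at hne
    have hkl : k = l' := by
      by_contra hkl
      simp [hkl] at hne
    rw [if_pos hkl, mul_one] at hne
    simp [hkl, hU _ _ hne, mul_assoc]
  have hVσ : IsHomog (fun q : n × (κ × κ') => γ q.1 * (η q.2.1 * η' q.2.2))
      (fun q : m × κ' => δ q.1 * η' q.2)
      ((V ⊗ₖ (1 : Matrix κ' κ' F)).submatrix σ.symm id) := by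
    rintro ⟨j, l, l'⟩ ⟨i, k⟩ hne
    simp only [Matrix.submatrix_apply, id, σ, Equiv.prodAssoc_symm_apply,
      Matrix.kroneckerMap_apply, Matrix.one_apply] at hne
    have hkl : l' = k := by
      by_contra hkl
      simp [hkl] at hne
    rw [if_pos hkl, mul_one] at hne
    simp [hkl, ← hV _ _ hne, mul_assoc]
  have h1 : (U ⊗ₖ (1 : Matrix κ' κ' F)).submatrix id σ.symm *
      (V ⊗ₖ (1 : Matrix κ' κ' F)).submatrix σ.symm id = 1 := by
    rw [Matrix.submatrix_mul_equiv, ← Matrix.mul_kronecker_mul, hUV]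
    simp
  have h2 : (V ⊗ₖ (1 : Matrix κ' κ' F)).submatrix σ.symm id *
      (U ⊗ₖ (1 : Matrix κ' κ' F)).submatrix id σ.symm = 1 := by
    have := Matrix.submatrix_mul_equiv (V ⊗ₖ (1 : Matrix κ' κ' F)) (U ⊗ₖ (1 : Matrix κ' κ' F))
      σ.symm (Equiv.refl _) σ.symm
    simp only [Equiv.coe_refl] at this
    rw [this, ← Matrix.mul_kronecker_mul, hVU]
    simp
  refine ⟨κ × κ', inferInstance, inferInstance, fun q => η q.1 * η' q.2,
    U' * (U ⊗ₖ (1 : Matrix κ' κ' F)).submatrix id σ.symm,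
    (V ⊗ₖ (1 : Matrix κ' κ' F)).submatrix σ.symm id * V', ?_, ?_, ?_, hU'.mul hUσ, hVσ.mul hV', ?_⟩
  · rw [mmul_univ_map]
  · rw [Matrix.mul_assoc, ← Matrix.mul_assoc _ _ V', h1, Matrix.one_mul, hUV']
  · rw [Matrix.mul_assoc, ← Matrix.mul_assoc V' U', hVU', Matrix.one_mul, h2]
  · intro X
    have hX : X ⊗ₖ (1 : Matrix (κ × κ') (κ × κ') F) =
        ((X ⊗ₖ (1 : Matrix κ κ F)) ⊗ₖ (1 : Matrix κ' κ' F)).submatrix σ.symm σ.symm := by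
      rw [← Matrix.one_kronecker_one, ← Matrix.kronecker_assoc]
      rfl
    have hA : (U * (X ⊗ₖ (1 : Matrix κ κ F)) * V) ⊗ₖ (1 : Matrix κ' κ' F) =
        (U ⊗ₖ (1 : Matrix κ' κ' F)).submatrix id σ.symm *
        ((X ⊗ₖ (1 : Matrix κ κ F)) ⊗ₖ (1 : Matrix κ' κ' F)).submatrix σ.symm σ.symm *
        (V ⊗ₖ (1 : Matrix κ' κ' F)).submatrix σ.symm id := by
      rw [Matrix.submatrix_mul_equiv, Matrix.submatrix_mul_equiv, ← Matrix.mul_kronecker_mul,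
        ← Matrix.mul_kronecker_mul, Matrix.mul_one, Matrix.mul_one, Matrix.submatrix_id_id]
    rw [AlgHom.comp_apply, hψ, hφ, hX, hA]
    simp only [Matrix.mul_assoc]

lemma HasMult.unique [Nonempty n] {γ : n → G} {δ : m → G}
    {φ : Matrix n n F →ₐ[F] Matrix m m F}
    {c d : Multiset G} (hc : HasMult γ δ φ c) (hd : HasMult γ δ φ d) : c = d := by
  obtain ⟨κ, _, _, η, U, V, rfl, hUV, hVU, hU, hV, hφ⟩ := hc
  obtain ⟨κ', _, _, η', U', V', rfl, hUV', hVU', hU', hV', hφ'⟩ := hd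
  obtain ⟨q₀⟩ := ‹Nonempty n›
  have key : ∀ X : Matrix n n F, U * (X ⊗ₖ (1 : Matrix κ κ F)) * V = U' * (X ⊗ₖ (1 : Matrix κ' κ' F)) * V' :=
    fun X => (hφ X).symm.trans (hφ' X)
  have hP := eq_one_kronecker_of_commute (W := V * U') (fun X => by
    have := congrArg (fun M : Matrix m m F => V * M * U') (key X)
    simp only [Matrix.mul_assoc, hVU', Matrix.mul_one] at this
    simp only [Matrix.mul_assoc]
    rw [← this, ← Matrix.mul_assoc V U, hVU, Matrix.one_mul]) q₀
  have hR := eq_one_kronecker_of_commute (W := V' * U) (fun X => by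
    have := congrArg (fun M : Matrix m m F => V' * M * U) (key X)
    simp only [Matrix.mul_assoc, hVU, Matrix.mul_one] at this
    simp only [Matrix.mul_assoc]
    rw [this, ← Matrix.mul_assoc V' U', hVU', Matrix.one_mul]) q₀
  have hPR : (V * U') * (V' * U) = 1 := by
    rw [Matrix.mul_assoc, ← Matrix.mul_assoc U', hUV', Matrix.one_mul, hVU]
  have hRP : (V' * U) * (V * U') = 1 := by
    rw [Matrix.mul_assoc, ← Matrix.mul_assoc U, hUV, Matrix.one_mul, hVU']
  have hP' : IsHomog η η' (Matrix.of (fun k k' => (V * U') (q₀, k) (q₀, k'))) := fun k k' h =>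
    mul_left_cancel ((hV.mul hU') (q₀, k) (q₀, k') h)
  have hR' : IsHomog η' η (Matrix.of (fun k k' => (V' * U) (q₀, k) (q₀, k'))) := fun k k' h =>
    mul_left_cancel ((hV'.mul hU) (q₀, k) (q₀, k') h)
  refine hP'.map_eq hR' ?_ ?_
  · rw [hP, hR, ← Matrix.mul_kronecker_mul, Matrix.one_mul] at hPR
    ext k k'
    have := congrFun (congrFun hPR (q₀, k)) (q₀, k')
    simpa [Matrix.kroneckerMap_apply, Matrix.one_apply] using this
  · rw [hP, hR, ← Matrix.mul_kronecker_mul, Matrix.one_mul] at hRP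
    ext k k'
    have := congrFun (congrFun hRP (q₀, k)) (q₀, k')
    simpa [Matrix.kroneckerMap_apply, Matrix.one_apply] using this

lemma hasMult_conjHom {δ : m → G} {W W' : Matrix m m F} (h : W * W' = 1) (h' : W' * W = 1)
    (hW : IsHomog δ δ W) (hW' : IsHomog δ δ W') : HasMult δ δ (conjHom W W' h h') {1} := by
  let σ := Equiv.prodPUnit.{0, 0} m
  refine ⟨PUnit, inferInstance, inferInstance, fun _ => 1, W.submatrix id σ, W'.submatrix σ id,
    by simp, ?_, ?_, ?_, ?_, ?_⟩
  · rw [Matrix.submatrix_mul_equiv, h]; simp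
  · have := Matrix.submatrix_mul_equiv W' W σ (Equiv.refl m) σ
    simp only [Equiv.coe_refl] at this
    rw [this, h']; simp
  · intro p q hne
    simpa using hW p q.1 hne
  · intro q p hne
    simpa using hW' q.1 p hne
  · intro X
    have : X ⊗ₖ (1 : Matrix PUnit.{1} PUnit.{1} F) = X.submatrix σ σ := by
      ext ⟨i, k⟩ ⟨j, l⟩
      simp [Matrix.kroneckerMap_apply, σ, Equiv.prodPUnit]
    rw [this, Matrix.submatrix_mul_equiv, Matrix.submatrix_mul_equiv, conjHom_apply]
    simp

lemma HasMult.exists_conj {γ : n → G} {δ : m → G}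
    {φ ψ : Matrix n n F →ₐ[F] Matrix m m F} {c : Multiset G}
    (hφ : HasMult γ δ φ c) (hψ : HasMult γ δ ψ c) :
    ∃ θ : Matrix m m F →ₐ[F] Matrix m m F, HasMult δ δ θ {1} ∧ θ.comp φ = ψ := by
  obtain ⟨κ, _, _, η, U, V, rfl, hUV, hVU, hU, hV, hφ⟩ := hφ
  obtain ⟨κ', _, _, η', U', V', hη, hUV', hVU', hU', hV', hψ⟩ := hψ
  obtain ⟨σ, hσ⟩ := exists_equiv_of_map_eq hη
  let τ : n × κ ≃ n × κ' := (Equiv.refl n).prodCongr σ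
  have hU'' : IsHomog δ (fun q : n × κ => γ q.1 * η q.2) (U'.submatrix id τ) := by
    intro p q hne
    refine (hU' _ _ hne).trans ?_
    simp [τ, ← hσ]
  have hV'' : IsHomog (fun q : n × κ => γ q.1 * η q.2) δ (V'.submatrix τ id) := by
    intro q p hne
    refine Eq.trans ?_ (hV' _ _ hne)
    simp [τ, ← hσ]
  have h1 : U'.submatrix id τ * V'.submatrix τ id = 1 := by
    rw [Matrix.submatrix_mul_equiv, hUV']; simp
  have h2 : V'.submatrix τ id * U'.submatrix id τ = 1 := by
    have := Matrix.submatrix_mul_equiv V' U' τ (Equiv.refl m) τ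
    simp only [Equiv.coe_refl] at this
    rw [this, hVU']; simp
  have h3 : ∀ X : Matrix n n F, X ⊗ₖ (1 : Matrix κ κ F) =
      (X ⊗ₖ (1 : Matrix κ' κ' F)).submatrix τ τ := by
    intro X
    ext ⟨i, k⟩ ⟨j, l⟩
    simp [Matrix.kroneckerMap_apply, τ, Matrix.one_apply]
  refine ⟨conjHom (U'.submatrix id τ * V) (U * V'.submatrix τ id) ?_ ?_,
    hasMult_conjHom _ _ (hU''.mul hV) (hU.mul hV''), ?_⟩
  · rw [Matrix.mul_assoc, ← Matrix.mul_assoc V, hVU, Matrix.one_mul, h1]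
  · rw [Matrix.mul_assoc, ← Matrix.mul_assoc _ _ V, h2, Matrix.one_mul, hUV]
  · refine AlgHom.ext fun X => ?_
    rw [AlgHom.comp_apply, conjHom_apply, hφ, hψ]
    simp only [Matrix.mul_assoc]
    rw [← Matrix.mul_assoc V U, hVU, Matrix.one_mul, ← Matrix.mul_assoc V U, hVU, Matrix.one_mul,
      h3, Matrix.submatrix_mul_equiv, Matrix.submatrix_mul_equiv]
    simp

end Multiplicity

section Existence

variable {F : Type} [Field F] {G : Type} {m n : Type} [Fintype m] [Fintype n]
  [DecidableEq m] [DecidableEq n]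

lemma IsHomog.exists_factor_of_idempotent [Fintype G] {δ : m → G} {e : Matrix m m F}
    (he : IsHomog δ δ e) (hee : e * e = e) :
    ∃ (κ : Type) (_ : Fintype κ) (_ : DecidableEq κ) (η : κ → G) (R : Matrix m κ F)
      (S : Matrix κ m F), R * S = e ∧ S * R = 1 ∧ IsHomog δ η R ∧ IsHomog η δ S := by
  let W : G → Submodule F (m → F) := fun g =>
    { carrier := {v | e.mulVec v = v ∧ ∀ p, v p ≠ 0 → δ p = g}
      add_mem' := by
        rintro v w ⟨hv, hv'⟩ ⟨hw, hw'⟩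
        refine ⟨by rw [Matrix.mulVec_add, hv, hw], fun p hp => ?_⟩
        by_cases h : v p = 0
        · exact hw' p fun h' => hp (by simp [h, h'])
        · exact hv' p h
      zero_mem' := ⟨by simp, fun p hp => absurd rfl hp⟩
      smul_mem' := by
        rintro c v ⟨hv, hv'⟩
        refine ⟨by rw [Matrix.mulVec_smul, hv], fun p hp => hv' p fun h => hp (by simp [h])⟩ }
  let ρ : G → (m → F) →ₗ[F] (m → F) := fun g =>
    { toFun := fun v p => if δ p = g then v p else 0
      map_add' := fun v w => by ext p; by_cases h : δ p = g <;> simp [h]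
      map_smul' := fun c v => by ext p; by_cases h : δ p = g <;> simp [h] }
  have hρ : ∀ g v p, ρ g v p = if δ p = g then v p else 0 := fun g v p => rfl
  let π : ∀ g, (m → F) →ₗ[F] W g := fun g => (e.mulVecLin.comp (ρ g)).codRestrict (W g) fun v => by
    refine ⟨by simp [hee], fun p hp => ?_⟩
    obtain ⟨q, -, hq⟩ := Finset.exists_ne_zero_of_sum_ne_zero
      (by simpa [Matrix.mulVec, dotProduct] using hp)
    refine (he p q (left_ne_zero_of_mul hq)).trans ?_
    by_contra hne
    exact right_ne_zero_of_mul hq (by rw [hρ, if_neg hne])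
  have hπ : ∀ g v, ((π g v : W g) : m → F) = e.mulVec (ρ g v) := fun g v => rfl
  let b := fun g => Module.finBasis F (W g)
  have hbW : ∀ g (v : W g), π g v = v := by
    rintro g ⟨v, hv, hv'⟩
    refine Subtype.ext ?_
    have : ρ g v = v := by
      ext p
      rw [hρ]
      split_ifs with h
      · rfl
      · by_contra h'
        exact h (hv' p (Ne.symm h'))
    rw [hπ]
    simp only [this, hv]
  have hbW' : ∀ g g' (v : W g'), g ≠ g' → π g v = 0 := by
    rintro g g' ⟨v, hv, hv'⟩ hne
    refine Subtype.ext ?_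
    have : ρ g v = 0 := by
      ext p
      rw [hρ]
      split_ifs with h
      · by_contra h'
        exact hne (h.symm.trans (hv' p h'))
      · rfl
    rw [hπ]
    simp [this]
  have hρs : ∀ g p, ρ g (Pi.single p 1) = if δ p = g then Pi.single p 1 else 0 := by
    intro g p
    ext q
    rw [hρ]
    by_cases h : q = p
    · subst h
      split_ifs <;> simp
    · split_ifs <;> simp [h]
  refine ⟨(g : G) × Fin (Module.finrank F (W g)), inferInstance, inferInstance, fun k => k.1,
    Matrix.of fun p k => (b k.1 k.2 : m → F) p,
    Matrix.of fun k p => (b k.1).repr (π k.1 (Pi.single p 1)) k.2, ?_, ?_, ?_, ?_⟩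
  · ext p p'
    simp only [Matrix.mul_apply, Matrix.of_apply, Fintype.sum_sigma]
    have h1 : ∀ g, ∑ j, (b g j : m → F) p * (b g).repr (π g (Pi.single p' 1)) j =
        if δ p' = g then e p p' else 0 := by
      intro g
      have h2 := congrArg (fun v : W g => (v : m → F) p) ((b g).sum_repr (π g (Pi.single p' 1)))
      simp only [Submodule.coe_sum, Submodule.coe_smul, Finset.sum_apply, Pi.smul_apply,
        smul_eq_mul] at h2
      rw [Finset.sum_congr rfl fun j _ => mul_comm _ _, h2, hπ, hρs]
      split_ifs <;> simp
    simp [h1]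
  · ext ⟨g, j⟩ ⟨g', j'⟩
    simp only [Matrix.mul_apply, Matrix.of_apply]
    have h1 := LinearMap.pi_apply_eq_sum_univ
      ((Finsupp.lapply j).comp ((b g).repr.toLinearMap.comp (π g))) (b g' j' : m → F)
    have h2 : ∑ p, (b g).repr (π g (Pi.single p 1)) j * (b g' j' : m → F) p =
        (b g).repr (π g (b g' j' : m → F)) j := by
      simp only [LinearMap.comp_apply, Finsupp.lapply_apply, LinearEquiv.coe_coe, smul_eq_mul]
        at h1
      rw [h1]
      refine Finset.sum_congr rfl fun p _ => ?_
      rw [mul_comm]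
      congr 4
      ext q
      simp [Pi.single_apply, eq_comm]
    rw [h2]
    by_cases hg : g = g'
    · subst hg
      rw [hbW]
      by_cases hj : j = j'
      · subst hj
        rw [Module.Basis.repr_self, Finsupp.single_eq_same, Matrix.one_apply_eq]
      · rw [Module.Basis.repr_self, Finsupp.single_eq_of_ne hj,
          Matrix.one_apply_ne (by simpa using hj)]
    · rw [hbW' _ _ _ hg, Matrix.one_apply_ne (by simp [hg])]
      simp
  · rintro p ⟨g, j⟩ h
    exact (b g j).2.2 p h
  · rintro ⟨g, j⟩ p h
    by_contra hne
    refine h ?_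
    have : π g (Pi.single p 1) = 0 := by
      refine Subtype.ext ?_
      rw [hπ, hρs, if_neg (Ne.symm hne)]
      simp
    simp [this]

variable [CommGroup G] [DecidableEq G]

omit [Fintype n] in
lemma single_mem_elemGrading (γ : n → G) (i j : n) :
    (Matrix.single i j 1 : Matrix n n F) ∈ elemGrading γ (γ i * (γ j)⁻¹) := by
  rw [mem_elemGrading]
  intro p q h
  have : i = p ∧ j = q := by
    by_contra h'
    exact h (by rw [Matrix.single_apply, if_neg h'])
  simp [this]

theorem IsGradedHom.exists_hasMult [Fintype G] [Nonempty n] {γ : n → G} {δ : m → G}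
    {φ : Matrix n n F →ₐ[F] Matrix m m F}
    (hφ : IsGradedHom F (elemGrading γ) (elemGrading δ) φ) : ∃ c, HasMult γ δ φ c := by
  obtain ⟨q₀⟩ := ‹Nonempty n›
  have hs : ∀ i j, IsHomog δ (fun p => (γ i * (γ j)⁻¹) * δ p) (φ (Matrix.single i j 1)) :=
    fun i j => mem_elemGrading_iff_isHomog.mp (hφ _ ⟨_, single_mem_elemGrading γ i j, rfl⟩)
  have hmul : ∀ i j k l, φ (Matrix.single i j 1) * φ (Matrix.single k l 1) =
      if j = k then φ (Matrix.single i l 1) else 0 := by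
    intro i j k l
    rw [← map_mul]
    split_ifs with h
    · rw [h, Matrix.single_mul_single_same, mul_one]
    · rw [Matrix.single_mul_single_of_ne _ _ _ _ h, map_zero]
  obtain ⟨κ, _, _, η, R, S, hRS, hSR, hR, hS⟩ := IsHomog.exists_factor_of_idempotent
    (e := φ (Matrix.single q₀ q₀ 1)) (δ := δ) (by simpa using hs q₀ q₀) (by simp [hmul])
  let U : Matrix m (n × κ) F := Matrix.of fun p q => (φ (Matrix.single q.1 q₀ 1) * R) p q.2
  let V : Matrix (n × κ) m F := Matrix.of fun q p => (S * φ (Matrix.single q₀ q.1 1)) q.2 p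
  have hUV : U * V = 1 := by
    have h1 : U * V = ∑ q, φ (Matrix.single q q 1) := by
      ext p p'
      rw [Matrix.mul_apply, Fintype.sum_prod_type, Matrix.sum_apply]
      refine Finset.sum_congr rfl fun q _ => ?_
      have : φ (Matrix.single q q 1) =
          (φ (Matrix.single q q₀ 1) * R) * (S * φ (Matrix.single q₀ q 1)) := by
        rw [Matrix.mul_assoc, ← Matrix.mul_assoc R, hRS, hmul, if_pos rfl, hmul, if_pos rfl]
      rw [this, Matrix.mul_apply]
      rfl
    rw [h1, ← map_sum]
    rw [Matrix.sum_single_one, map_one]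
  refine ⟨_, κ, inferInstance, inferInstance, fun k => (γ q₀)⁻¹ * η k, U, V, rfl, hUV, ?_, ?_, ?_,
    ?_⟩
  · ext ⟨q, k⟩ ⟨q', k'⟩
    have h1 : (V * U) (q, k) (q', k') =
        ((S * φ (Matrix.single q₀ q 1)) * (φ (Matrix.single q' q₀ 1) * R)) k k' := by
      rw [Matrix.mul_apply, Matrix.mul_apply]
      rfl
    rw [h1, Matrix.mul_assoc, ← Matrix.mul_assoc _ _ R, hmul]
    split_ifs with h
    · rw [← hRS, Matrix.mul_assoc, hSR, Matrix.mul_one, hSR]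
      simp [Matrix.one_apply, h]
    · simp [h]
  · rintro p ⟨q, k⟩ h
    have := ((hs q q₀).mul (hR.const_mul _)) p k h
    simpa [mul_assoc] using this
  · rintro ⟨q, k⟩ p h
    have := (hS.mul (hs q₀ q)) k p h
    change γ q * ((γ q₀)⁻¹ * η k) = δ p
    rw [this]
    group
  · intro X
    have h1 : U * (X ⊗ₖ (1 : Matrix κ κ F)) = φ X * U := by
      ext p ⟨q, k⟩
      have h2 : X * Matrix.single q q₀ 1 = ∑ q', X q' q • Matrix.single q' q₀ 1 := by
        ext a c
        simp [Matrix.mul_apply, Matrix.sum_apply, Matrix.single_apply, ite_and]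
      have h3 : (φ X * U) p (q, k) = (φ X * (φ (Matrix.single q q₀ 1) * R)) p k := by
        rw [Matrix.mul_apply, Matrix.mul_apply]
        rfl
      rw [h3, ← Matrix.mul_assoc, ← map_mul, h2, map_sum]
      rw [Matrix.mul_apply, Fintype.sum_prod_type, Matrix.sum_mul, Matrix.sum_apply]
      refine Finset.sum_congr rfl fun q' _ => ?_
      rw [map_smul, Matrix.smul_mul, Matrix.smul_apply]
      simp [U, Matrix.kroneckerMap_apply, Matrix.one_apply, mul_comm]
    rw [h1, Matrix.mul_assoc, hUV, Matrix.mul_one]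

end Existence

section Label

variable {F : Type} [Field F] {G : Type} [CommGroup G] [Fintype G] [DecidableEq G]

omit [Fintype G] [DecidableEq G] in
lemma card_mmul (x y : Multiset G) :
    Multiset.card (mmul x y) = Multiset.card x * Multiset.card y := by
  have := evChar_mmul 1 x y
  simp only [evChar_one] at this
  exact_mod_cast this

theorem HasLabel.exists_hasMult {n m k : ℕ} {γ : Fin n → G} {δ : Fin m → G} {η : Fin k → G}
    {ι : Matrix (Fin n) (Fin n) F →ₐ[F] Matrix (Fin m) (Fin m) F} (h : HasLabel γ δ η ι)
    (hn : 0 < n) (hm : 0 < m) :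
    ∃ g, HasMult γ δ ι (mmul {g} (Finset.univ.val.map η)) := by
  obtain ⟨hι, e, he⟩ := h
  have : Nonempty (Fin n) := ⟨⟨0, hn⟩⟩
  have : Nonempty (Fin m) := ⟨⟨0, hm⟩⟩
  obtain ⟨c, hc⟩ := hι.exists_hasMult
  have hcard := congrArg Multiset.card hc.eq_mmul
  obtain ⟨κ, _, _, η₀, U, V, rfl, hUV, hVU, hU, hV, hιU⟩ := id hc
  rw [card_mmul] at hcard
  simp only [Multiset.card_map, Finset.card_val, Finset.card_univ, Fintype.card_fin] at hcard
  have hκ : 0 < Fintype.card κ := Nat.pos_of_ne_zero fun h0 => by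
    rw [h0, mul_zero] at hcard
    exact hm.ne' hcard
  have : Nonempty κ := Fintype.card_pos_iff.mp hκ
  let Ψ := (conjHom U V hUV hVU).comp (kronOneLeft F κ (Fin n))
  have hΨ : ∀ Y, Ψ Y = U * ((1 : Matrix (Fin n) (Fin n) F) ⊗ₖ Y) * V := fun Y => rfl
  have hmem : ∀ Y, Ψ Y ∈ Subalgebra.centralizer F (Set.range ι) := by
    intro Y
    rw [Subalgebra.mem_centralizer_iff]
    rintro _ ⟨X, rfl⟩
    have hX : ι X = conjHom U V hUV hVU (kronOneRight F κ (Fin n) X) := hιU X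
    have hcomm : kronOneRight F κ (Fin n) X * kronOneLeft F κ (Fin n) Y =
        kronOneLeft F κ (Fin n) Y * kronOneRight F κ (Fin n) X := by
      change X ⊗ₖ (1 : Matrix κ κ F) * (1 : Matrix (Fin n) (Fin n) F) ⊗ₖ Y =
        (1 : Matrix (Fin n) (Fin n) F) ⊗ₖ Y * X ⊗ₖ (1 : Matrix κ κ F)
      rw [← Matrix.mul_kronecker_mul, ← Matrix.mul_kronecker_mul]
      simp
    rw [hX, AlgHom.comp_apply, ← map_mul, ← map_mul, hcomm]
  let Ψ' := Ψ.codRestrict _ hmem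
  have hsurj : Function.Surjective Ψ' := by
    rintro ⟨Z, hZ⟩
    rw [Subalgebra.mem_centralizer_iff] at hZ
    have hW := eq_one_kronecker_of_commute (W := V * Z * U) (fun X => by
      have h1 := hZ _ ⟨X, rfl⟩
      rw [hιU] at h1
      have h2 := congrArg (fun M : Matrix (Fin m) (Fin m) F => V * M * U) h1
      simp only [Matrix.mul_assoc, hVU, Matrix.mul_one] at h2
      rw [← Matrix.mul_assoc V U, hVU, Matrix.one_mul] at h2
      simp only [Matrix.mul_assoc]
      exact h2.symm) ⟨0, hn⟩
    refine ⟨_, Subtype.ext (Eq.trans (congrArg (fun M => U * M * V) hW.symm) ?_)⟩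
    rw [Matrix.mul_assoc V, ← Matrix.mul_assoc U V, hUV, Matrix.one_mul, Matrix.mul_assoc, hUV,
      Matrix.mul_one]
  have hgr : IsGradedHom F (elemGrading η₀) (elemGrading η) (e.toAlgHom.comp Ψ') := by
    rintro g _ ⟨Y, hY, rfl⟩
    rw [SetLike.mem_coe, mem_elemGrading] at hY
    rw [← he g]
    refine ⟨Ψ' Y, ?_, rfl⟩
    change Ψ Y ∈ elemGrading δ g
    rw [mem_elemGrading_iff_isHomog, hΨ]
    refine (hU.mul ?_).mul (hV.const_mul g)
    rintro ⟨i, a⟩ ⟨j, b⟩ hne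
    rw [Matrix.kroneckerMap_apply, Matrix.one_apply] at hne
    have hij : i = j := by
      by_contra hij
      simp [hij] at hne
    rw [if_pos hij, one_mul] at hne
    simp [hij, hY a b hne, mul_left_comm]
  obtain ⟨d, hd⟩ := hgr.exists_hasMult
  have hηd := hd.eq_mmul
  have hcard' := congrArg Multiset.card hηd
  rw [card_mmul] at hcard'
  simp only [Multiset.card_map, Finset.card_val, Finset.card_univ, Fintype.card_fin] at hcard'
  have hk : 0 < k := by
    rcases Nat.eq_zero_or_pos k with rfl | hk
    · have h1 : (1 : Subalgebra.centralizer F (Set.range ι)) = 0 :=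
        e.injective (Subsingleton.elim _ _)
      exact absurd (congrArg Subtype.val h1) one_ne_zero
    · exact hk
  have hle := LinearMap.finrank_le_finrank_of_surjective
    (f := (e.toAlgHom.comp Ψ').toLinearMap)
    (show Function.Surjective (e ∘ Ψ') from e.surjective.comp hsurj)
  simp only [Module.finrank_matrix, Module.finrank_self, mul_one, Fintype.card_fin] at hle
  have hd1 : Multiset.card d = 1 := by
    have h1 : k ≤ Fintype.card κ := by nlinarith
    rw [hcard'] at h1 hk
    have h2 : 0 < Multiset.card d := pos_of_mul_pos_right hk (Nat.zero_le _)
    nlinarith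
  obtain ⟨g, rfl⟩ := Multiset.card_eq_one.mp hd1
  refine ⟨g⁻¹, ?_⟩
  have : mmul {g⁻¹} (Finset.univ.val.map η) = Finset.univ.val.map η₀ :=
    multiset_eq_of_evChar_eq fun χ => by
      simp [hηd, evChar_mmul, evChar_singleton, mul_comm]
  rwa [this]

end Label

section BarredCharacters

variable {G : Type} [CommGroup G]

/-- Evaluation of a character at `\bar x`. -/
def evBar (χ : G →* ℂˣ) (x : Multiset G) : ℂ := evChar χ (mbarM x)

lemma evBar_mmul (χ : G →* ℂˣ) (x y : Multiset G) :
    evBar χ (mmul x y) = evBar χ x * evBar χ y := by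
  simp [evBar, evChar_mbarM, evChar_mmul]

lemma evBar_mbarM (χ : G →* ℂˣ) (x : Multiset G) : evBar χ (mbarM x) = evChar χ x := by
  rw [evBar, mbarM_mbarM]

lemma evBar_one_singleton (χ : G →* ℂˣ) : evBar χ ({1} : Multiset G) = 1 := by
  simp [evBar, evChar_mbarM, evChar_one_singleton]

lemma evChar_bprod_mul_prod_Ico (χ : G →* ℂˣ) (c : ℕ → Multiset G) {i j : ℕ} (hij : i ≤ j) :
    evChar χ (bprod c i) * ∏ l ∈ Finset.Ico i j, evBar χ (c l) = evChar χ (bprod c j) := by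
  simp only [evChar_bprod, evBar]
  exact Finset.prod_range_mul_prod_Ico _ hij

variable [Fintype G]

lemma evBar_ne_zero_iff {χ : G →* ℂˣ} {x : Multiset G} : evBar χ x ≠ 0 ↔ χ ∈ suppM x :=
  evChar_mbarM_ne_zero_iff χ x

lemma multiset_eq_of_evBar_eq {x y : Multiset G} (h : ∀ χ : G →* ℂˣ, evBar χ x = evBar χ y) :
    x = y := by
  rw [← mbarM_mbarM x, ← mbarM_mbarM y]
  exact congrArg mbarM (multiset_eq_of_evChar_eq h)

lemma evChar_bprod_ne_zero {S : Set (G →* ℂˣ)} {c : ℕ → Multiset G} (hc : ∀ i, suppM (c i) = S)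
    {χ : G →* ℂˣ} (hχ : χ ∈ S) (i : ℕ) : evChar χ (bprod c i) ≠ 0 := by
  rw [evChar_bprod]
  exact Finset.prod_ne_zero_iff.mpr fun l _ => evBar_ne_zero_iff.mpr (by rwa [hc])

lemma prod_Ico_evBar_ne_zero {S : Set (G →* ℂˣ)} {c : ℕ → Multiset G}
    (hc : ∀ i, suppM (c i) = S) {χ : G →* ℂˣ} (hχ : χ ∈ S) (i j : ℕ) :
    ∏ l ∈ Finset.Ico i j, evBar χ (c l) ≠ 0 :=
  Finset.prod_ne_zero_iff.mpr fun l _ => evBar_ne_zero_iff.mpr (by rwa [hc])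

lemma prod_Ico_evBar_eq_zero {S : Set (G →* ℂˣ)} {c : ℕ → Multiset G}
    (hc : ∀ i, suppM (c i) = S) {χ : G →* ℂˣ} (hχ : χ ∉ S) {i j : ℕ} (hij : i < j) :
    ∏ l ∈ Finset.Ico i j, evBar χ (c l) = 0 := by
  refine Finset.prod_eq_zero (Finset.left_mem_Ico.mpr hij) ?_
  by_contra h
  exact hχ (hc i ▸ evBar_ne_zero_iff.mp h)

end BarredCharacters

/-- A presentation of `(L, ℒ)` as the union of a chain of elementarily graded matrix algebras
`M_{x i}(F)`, in which the `i`-th inclusion has multiplicity `c i`. -/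
structure MultChain (F : Type) [Field F] {G : Type} [CommGroup G] [DecidableEq G]
    {L : Type} [Ring L] [Algebra F L] (ℒ : G → Submodule F L) (x c : ℕ → Multiset G) where
  n : ℕ → ℕ
  γ : ∀ i, Fin (n i) → G
  φ : ∀ i, Matrix (Fin (n i)) (Fin (n i)) F →ₐ[F] L
  n_pos : ∀ i, 0 < n i
  reps : ∀ i, Finset.univ.val.map (γ i) = x i
  injective : ∀ i, Function.Injective (φ i)
  step : ∀ i, ∃ ι, HasMult (γ i) (γ (i + 1)) ι (c i) ∧ (φ (i + 1)).comp ι = φ i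
  exhausts : ∀ z : L, ∃ i, z ∈ (φ i).range
  component : ∀ g, (ℒ g : Set L) = ⋃ i, φ i '' (elemGrading (F := F) (γ i) g : Set (Matrix (Fin (n i)) (Fin (n i)) F))

namespace MultChain

variable {F : Type} [Field F] {G : Type} [CommGroup G] [Fintype G] [DecidableEq G]
  {L : Type} [Ring L] [Algebra F L] {ℒ : G → Submodule F L} {x c : ℕ → Multiset G}
  (C : MultChain F ℒ x c)

omit [Fintype G] in
lemma nonempty (i : ℕ) : Nonempty (Fin (C.n i)) := ⟨⟨0, C.n_pos i⟩⟩

lemma exists_transition {i j : ℕ} (hij : i ≤ j) :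
    ∃ t p, HasMult (C.γ i) (C.γ j) t p ∧ (C.φ j).comp t = C.φ i ∧
      ∀ χ, evBar χ p = ∏ l ∈ Finset.Ico i j, evBar χ (c l) := by
  induction j, hij using Nat.le_induction with
  | base =>
    refine ⟨AlgHom.id F _, {1}, ?_, AlgHom.comp_id _, fun χ => by simp [evBar_one_singleton]⟩
    have h := hasMult_conjHom (F := F) (δ := C.γ i) (W := 1) (W' := 1) (by simp) (by simp)
      (fun p q h => by by_contra h'; exact h (Matrix.one_apply_ne fun h'' => h' (by rw [h''])))
      (fun p q h => by by_contra h'; exact h (Matrix.one_apply_ne fun h'' => h' (by rw [h''])))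
    convert h using 1
    ext1 X
    simp [conjHom_apply]
  | succ j hij ih =>
    obtain ⟨t, p, ht, htφ, hp⟩ := ih
    obtain ⟨ι, hι, hιφ⟩ := C.step j
    refine ⟨ι.comp t, mmul p (c j), hι.comp ht, ?_, fun χ => ?_⟩
    · rw [← AlgHom.comp_assoc, hιφ, htφ]
    · rw [evBar_mmul, hp, Finset.prod_Ico_succ_top hij]

lemma exists_lift {i j : ℕ} (hij : i ≤ j) (y : Matrix (Fin (C.n i)) (Fin (C.n i)) F) :
    ∃ y', C.φ j y' = C.φ i y ∧ ∀ g, y ∈ elemGrading (C.γ i) g → y' ∈ elemGrading (C.γ j) g := by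
  obtain ⟨t, p, ht, htφ, -⟩ := C.exists_transition hij
  exact ⟨t y, DFunLike.congr_fun htφ y, fun g hy => ht.isGradedHom g ⟨y, hy, rfl⟩⟩

omit [Fintype G] in
lemma map_mem {i : ℕ} {g : G} {y : Matrix (Fin (C.n i)) (Fin (C.n i)) F}
    (hy : y ∈ elemGrading (C.γ i) g) : C.φ i y ∈ ℒ g := by
  rw [← SetLike.mem_coe, C.component]
  exact Set.mem_iUnion.mpr ⟨i, y, hy, rfl⟩

omit [Fintype G] in
lemma exists_of_mem {g : G} {z : L} (hz : z ∈ ℒ g) :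
    ∃ i, ∃ y ∈ elemGrading (C.γ i) g, C.φ i y = z := by
  rw [← SetLike.mem_coe, C.component] at hz
  obtain ⟨i, y, hy, rfl⟩ := Set.mem_iUnion.mp hz
  exact ⟨i, y, hy, rfl⟩

include C in
lemma evBar_x (χ : G →* ℂˣ) (i : ℕ) :
    evBar χ (x i) = evBar χ (x 0) * evChar χ (bprod c i) := by
  obtain ⟨t, p, ht, -, hp⟩ := C.exists_transition (Nat.zero_le i)
  have := ht.eq_mmul
  rw [C.reps, C.reps] at this
  rw [this, evBar_mmul, hp, evChar_bprod, Finset.range_eq_Ico]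
  rfl

end MultChain

section Extraction

variable {F : Type} [Field F] {G : Type} [CommGroup G] [Fintype G] [DecidableEq G]
  {L : Type} [Ring L] [Algebra F L] {ℒ : G → Submodule F L} {x a : ℕ → Multiset G}

theorem IsElemLimit.exists_multChain (h : IsElemLimit F L ℒ x a) (hx : x 0 ≠ 0) :
    ∃ (c : ℕ → Multiset G) (g : ℕ → G), (∀ i, c i = mmul {g i} (a i)) ∧
      Nonempty (MultChain F ℒ x c) := by
  obtain ⟨-, n, γ, k, η, ι, hγ, hη, hι, hlab, φ, hφ, hcomp, hex, hgr⟩ := h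
  have hn : ∀ i, 0 < n i := by
    intro i
    induction i with
    | zero =>
      refine Nat.pos_of_ne_zero fun h0 => hx ?_
      rw [← hγ 0, ← Multiset.card_eq_zero]
      simp [h0]
    | succ i ih =>
      refine Nat.pos_of_ne_zero fun h0 => ?_
      have : Nonempty (Fin (n i)) := ⟨⟨0, ih⟩⟩
      have : IsEmpty (Fin (n (i + 1))) := by rw [h0]; infer_instance
      exact one_ne_zero (hι i (Subsingleton.elim (ι i 1) (ι i 0)))
  choose g hg using fun i => (hlab i).exists_hasMult (hn i) (hn (i + 1))
  refine ⟨fun i => mmul {g i} (a i), g, fun i => rfl, ⟨n, γ, φ, hn, hγ, hφ, fun i => ?_, hex, hgr⟩⟩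
  have := hg i
  rw [hη i] at this
  exact ⟨ι i, this, hcomp i⟩

omit [Fintype G] in
lemma IsElemLimit.subsingleton_iff (h : IsElemLimit F L ℒ x a) : Subsingleton L ↔ x 0 = 0 := by
  obtain ⟨-, n, γ, k, η, ι, hγ, hη, hι, hlab, φ, hφ, hcomp, hex, hgr⟩ := h
  have hx : x 0 = 0 ↔ n 0 = 0 := by
    rw [← hγ 0, ← Multiset.card_eq_zero]
    simp
  rw [hx]
  constructor
  · intro hL
    by_contra h0
    have : Nonempty (Fin (n 0)) := ⟨⟨0, Nat.pos_of_ne_zero h0⟩⟩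
    exact one_ne_zero (hφ 0 (Subsingleton.elim (φ 0 1) (φ 0 0)))
  · intro h0
    have : IsEmpty (Fin (n 0)) := by rw [h0]; infer_instance
    refine subsingleton_of_zero_eq_one ?_
    rw [← map_one (φ 0), ← map_zero (φ 0)]
    exact congrArg _ (Subsingleton.elim _ _)

omit [Fintype G] in
lemma IsElemLimit.label_eq_zero (h : IsElemLimit F L ℒ x a) [Subsingleton L] : a 0 = 0 := by
  obtain ⟨-, n, γ, k, η, ι, hγ, hη, hι, hlab, φ, hφ, hcomp, hex, hgr⟩ := h
  obtain ⟨-, e, -⟩ := hlab 0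
  have : Subsingleton (Matrix (Fin (n (0 + 1))) (Fin (n (0 + 1))) F) := (hφ (0 + 1)).subsingleton
  rw [← hη 0, ← Multiset.card_eq_zero]
  simp only [Multiset.card_map, Finset.card_val, Finset.card_univ, Fintype.card_fin]
  by_contra h0
  have : Nonempty (Fin (k 0)) := ⟨⟨0, Nat.pos_of_ne_zero h0⟩⟩
  exact one_ne_zero (e.symm.injective (Subsingleton.elim (e.symm 1) (e.symm 0)))

end Extraction

section Shift

variable {G : Type} [CommGroup G] {a c : ℕ → Multiset G} {g : ℕ → G}

lemma suppM_shift (g : G) (x : Multiset G) : suppM (mmul {g} x) = suppM x := by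
  ext χ
  simp [suppM, evChar_mmul, evChar_singleton]

lemma Kplus_subset_of_shift (h : ∀ i, c i = mmul {g i} (a i)) (S : Set (G →* ℂˣ)) :
    Kplus S a ⊆ Kplus S c := by
  rintro f ⟨i, z, hf⟩
  refine ⟨i, mmul {∏ l ∈ Finset.range i, (g l)⁻¹} z, fun χ => ?_⟩
  rw [hf]
  refine if_congr Iff.rfl ?_ rfl
  have hb : evChar χ (bprod c i) =
      (∏ l ∈ Finset.range i, (χ (g l) : ℂ)⁻¹) * evChar χ (bprod a i) := by
    rw [evChar_bprod, evChar_bprod, ← Finset.prod_mul_distrib]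
    refine Finset.prod_congr rfl fun l _ => ?_
    simp [h, evChar_mbarM, evChar_mmul, evChar_singleton]
  have hz : (∏ l ∈ Finset.range i, (χ (g l) : ℂ)⁻¹) ≠ 0 :=
    Finset.prod_ne_zero_iff.mpr fun l _ => by simp
  have hg : ((χ (∏ l ∈ Finset.range i, (g l)⁻¹) : ℂˣ) : ℂ) =
      ∏ l ∈ Finset.range i, (χ (g l) : ℂ)⁻¹ := by
    simp [map_prod, Units.coe_prod]
  rw [evChar_mmul, evChar_singleton, hb, hg, mul_div_mul_left _ _ hz]

lemma Kplus_shift [Fintype G] (h : ∀ i, c i = mmul {g i} (a i)) (S : Set (G →* ℂˣ)) :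
    Kplus S c = Kplus S a := by
  refine subset_antisymm (Kplus_subset_of_shift (g := fun i => (g i)⁻¹) (fun i => ?_) S)
    (Kplus_subset_of_shift h S)
  rw [h]
  exact multiset_eq_of_evChar_eq fun χ => by simp [evChar_mmul, evChar_singleton]

end Shift

section Gluing

variable {F : Type} [Field F] {G : Type} [CommGroup G]
  {L : Type} [Ring L] [Algebra F L] {ℒ : G → Submodule F L}
  {L' : Type} [Ring L'] [Algebra F L'] {ℒ' : G → Submodule F L'}

/-- A subalgebra of `L × L'` which is the graph of a graded bijection defines a graded
isomorphism. -/
lemma isGradedAlgIso_of_graph (Γ : Subalgebra F (L × L'))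
    (h₁ : ∀ p ∈ Γ, p.1 = 0 → p.2 = 0) (h₂ : ∀ p ∈ Γ, p.2 = 0 → p.1 = 0)
    (s₁ : ∀ u, ∃ v, (u, v) ∈ Γ) (s₂ : ∀ v, ∃ u, (u, v) ∈ Γ)
    (g₁ : ∀ g, ∀ u ∈ ℒ g, ∃ v ∈ ℒ' g, (u, v) ∈ Γ)
    (g₂ : ∀ g, ∀ v ∈ ℒ' g, ∃ u ∈ ℒ g, (u, v) ∈ Γ) :
    IsGradedAlgIso F ℒ ℒ' := by
  have b₁ : Function.Bijective ((AlgHom.fst F L L').comp Γ.val) := by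
    refine ⟨(injective_iff_map_eq_zero _).mpr fun p hp => ?_, fun u => ?_⟩
    · exact Subtype.ext (Prod.ext hp (h₁ _ p.2 hp))
    · obtain ⟨v, hv⟩ := s₁ u
      exact ⟨⟨_, hv⟩, rfl⟩
  have b₂ : Function.Bijective ((AlgHom.snd F L L').comp Γ.val) := by
    refine ⟨(injective_iff_map_eq_zero _).mpr fun p hp => ?_, fun v => ?_⟩
    · exact Subtype.ext (Prod.ext (h₂ _ p.2 hp) hp)
    · obtain ⟨u, hu⟩ := s₂ v
      exact ⟨⟨_, hu⟩, rfl⟩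
  let e := (AlgEquiv.ofBijective _ b₁).symm.trans (AlgEquiv.ofBijective _ b₂)
  have he : ∀ {u v}, (u, v) ∈ Γ → e u = v := by
    intro u v huv
    have : (AlgEquiv.ofBijective _ b₁).symm u = ⟨(u, v), huv⟩ := by
      rw [AlgEquiv.symm_apply_eq]
      rfl
    change (AlgEquiv.ofBijective _ b₂) ((AlgEquiv.ofBijective _ b₁).symm u) = v
    rw [this]
    rfl
  refine ⟨e, fun g => le_antisymm ?_ ?_⟩
  · rintro _ ⟨u, hu, rfl⟩
    obtain ⟨v, hv, huv⟩ := g₁ g u hu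
    exact (he huv).symm ▸ hv
  · intro v hv
    obtain ⟨u, hu, huv⟩ := g₂ g v hv
    exact ⟨u, hu, he huv⟩

end Gluing

section Compatibility

variable {F : Type} [Field F] {G : Type} [CommGroup G] [Fintype G] [DecidableEq G]
  {L : Type} [Ring L] [Algebra F L] {ℒ : G → Submodule F L}
  {L' : Type} [Ring L'] [Algebra F L'] {ℒ' : G → Submodule F L'}
  {S : Set (G →* ℂˣ)} {x c x' c' : ℕ → Multiset G} {b b' : Multiset G}

/-- The arithmetic data relating two chains of multiplicities. -/
structure Compat {G : Type} [CommGroup G] (S : Set (G →* ℂˣ)) (x c : ℕ → Multiset G)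
    (b : Multiset G) (x' c' : ℕ → Multiset G) (b' : Multiset G) : Prop where
  supp_label : ∀ i, suppM (c i) = S
  supp_label' : ∀ i, suppM (c' i) = S
  supp_init : suppM (x 0) ⊆ S
  supp_init' : suppM (x' 0) ⊆ S
  supp : suppM b = S
  supp' : suppM b' = S
  init : mmul b (mbarM (x 0)) = mmul b' (mbarM (x' 0))
  cone : mscale b (Kplus S c) = mscale b' (Kplus S c')

omit [Fintype G] [DecidableEq G] in
lemma Compat.symm (h : Compat S x c b x' c' b') : Compat S x' c' b' x c b :=
  ⟨h.supp_label', h.supp_label, h.supp_init', h.supp_init, h.supp', h.supp, h.init.symm,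
    h.cone.symm⟩

lemma Compat.exists_factor (h : Compat S x c b x' c' b') (C : MultChain F ℒ x c)
    (C' : MultChain F ℒ' x' c') (N j : ℕ) :
    ∃ i d, N < i ∧ (∀ χ ∉ S, evBar χ d = 0) ∧
      (∀ χ ∈ S, evChar χ b' * evChar χ (bprod c i) =
        evChar χ b * evChar χ (bprod c' j) * evBar χ d) ∧
      x i = mmul (x' j) d := by
  have hmem : (fun χ => evChar χ b' *
      (if χ ∈ S then evChar χ ({1} : Multiset G) / evChar χ (bprod c' j) else 0)) ∈
      mscale b (Kplus S c) := by
    rw [h.cone]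
    exact ⟨_, ⟨j, {1}, fun χ => rfl⟩, rfl⟩
  obtain ⟨f, ⟨i₀, z, hf⟩, hfe⟩ := hmem
  have hi : i₀ < max i₀ N + 1 := Nat.lt_succ_of_le (le_max_left _ _)
  obtain ⟨t, p, -, -, hp⟩ := C.exists_transition hi.le
  have hz : ∀ χ ∈ S, evChar χ b' * evChar χ (bprod c i₀) =
      evChar χ b * evChar χ (bprod c' j) * evChar χ z := by
    intro χ hχ
    have h1 := congrFun hfe χ
    simp only [hf, if_pos hχ, evChar_one_singleton] at h1
    have h2 := evChar_bprod_ne_zero h.supp_label hχ i₀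
    have h3 := evChar_bprod_ne_zero h.supp_label' hχ j
    field_simp at h1
    linear_combination -h1
  have hd0 : ∀ χ ∉ S, evBar χ (mmul (mbarM z) p) = 0 := by
    intro χ hχ
    rw [evBar_mmul, hp, prod_Ico_evBar_eq_zero h.supp_label hχ hi, mul_zero]
  have hd : ∀ χ ∈ S, evChar χ b' * evChar χ (bprod c (max i₀ N + 1)) =
      evChar χ b * evChar χ (bprod c' j) * evBar χ (mmul (mbarM z) p) := by
    intro χ hχ
    rw [evBar_mmul, hp, evBar_mbarM, ← evChar_bprod_mul_prod_Ico χ c hi.le, ← mul_assoc, hz χ hχ,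
      ← mul_assoc]
  refine ⟨max i₀ N + 1, mmul (mbarM z) p, Nat.lt_succ_of_le (le_max_right _ _), hd0, hd, ?_⟩
  refine multiset_eq_of_evBar_eq fun χ => ?_
  rw [evBar_mmul, C.evBar_x, C'.evBar_x]
  by_cases hχ : χ ∈ S
  · have hb' : evChar χ b' ≠ 0 := by
      have := h.supp'.symm ▸ hχ
      exact this
    have hinit := congrArg (evChar χ) h.init
    rw [evChar_mmul, evChar_mmul] at hinit
    change _ * evBar χ (x 0) = _ * evBar χ (x' 0) at hinit
    refine mul_left_cancel₀ hb' ?_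
    linear_combination evBar χ (x 0) * hd χ hχ +
      evChar χ (bprod c' j) * evBar χ (mmul (mbarM z) p) * hinit
  · rw [hd0 χ hχ]
    have : evBar χ (x 0) = 0 := by
      by_contra h0
      exact hχ (h.supp_init (evBar_ne_zero_iff.mp h0))
    rw [this, zero_mul, mul_zero]

/-- A graded embedding of some stage of the first chain into some stage of the second one,
of the multiplicity prescribed by `b` and `b'`. -/
structure Link (C : MultChain F ℒ x c) (C' : MultChain F ℒ' x' c') (S : Set (G →* ℂˣ))
    (b b' : Multiset G) where
  i : ℕ
  j : ℕ
  f : Matrix (Fin (C.n i)) (Fin (C.n i)) F →ₐ[F] Matrix (Fin (C'.n j)) (Fin (C'.n j)) F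
  mult : Multiset G
  hasMult : HasMult (C.γ i) (C'.γ j) f mult
  evBar_mult : ∀ χ ∈ S, evChar χ b * evChar χ (bprod c' j) =
    evChar χ b' * evChar χ (bprod c i) * evBar χ mult

variable {C : MultChain F ℒ x c} {C' : MultChain F ℒ' x' c'}

lemma Compat.nonempty_link (h : Compat S x c b x' c' b') (C : MultChain F ℒ x c)
    (C' : MultChain F ℒ' x' c') : Nonempty (Link C C' S b b') := by
  obtain ⟨j, d, -, -, hd, hx⟩ := h.symm.exists_factor C' C 0 0
  obtain ⟨f, hf⟩ := exists_hasMult (F := F) (γ := C.γ 0) (δ := C'.γ j) (c := d)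
    (by rw [C.reps, C'.reps, hx])
  exact ⟨⟨0, j, f, d, hf, hd⟩⟩

/-- A link from the first chain to the second is completed by a link back, such that the
composite is the inclusion. -/
lemma Link.exists_back (h : Compat S x c b x' c' b') (s : Link C C' S b b') :
    ∃ t : Link C' C S b' b, s.j ≤ t.i ∧ s.i < t.j ∧
      ∀ y z, C'.φ s.j (s.f y) = C'.φ t.i z → C.φ t.j (t.f z) = C.φ s.i y := by
  obtain ⟨i, d, hi, hd0, hd, hx⟩ := h.exists_factor C C' s.i s.j
  obtain ⟨g, hg⟩ := exists_hasMult (F := F) (γ := C'.γ s.j) (δ := C.γ i) (c := d)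
    (by rw [C.reps, C'.reps, hx])
  obtain ⟨t, p, ht, htφ, hp⟩ := C.exists_transition hi.le
  have hpd : mmul s.mult d = p := by
    refine multiset_eq_of_evBar_eq fun χ => ?_
    rw [evBar_mmul, hp]
    by_cases hχ : χ ∈ S
    · have hb' : evChar χ b' ≠ 0 := by
        have := h.supp'.symm ▸ hχ
        exact this
      refine mul_left_cancel₀ (mul_ne_zero hb' (evChar_bprod_ne_zero h.supp_label hχ s.i)) ?_
      have h1 := evChar_bprod_mul_prod_Ico χ c hi.le
      linear_combination -evBar χ d * s.evBar_mult χ hχ - hd χ hχ - evChar χ b' * h1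
    · rw [hd0 χ hχ, mul_zero, prod_Ico_evBar_eq_zero h.supp_label hχ hi]
  have hgf := hg.comp s.hasMult
  rw [hpd] at hgf
  obtain ⟨θ, hθ, hθt⟩ := hgf.exists_conj ht
  refine ⟨⟨s.j, i, θ.comp g, d, ?_, hd⟩, le_rfl, hi, fun y z hyz => ?_⟩
  · have := hθ.comp hg
    rwa [mmul_one_right] at this
  · obtain rfl := C'.injective _ hyz
    rw [← htφ, ← hθt]
    rfl

lemma Link.exists_next (h : Compat S x c b x' c' b') (s : Link C C' S b b') :
    ∃ s' : Link C C' S b b', s.i < s'.i ∧ s.j < s'.j ∧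
      (∀ y, ∃ v, C.φ s'.i v = C.φ s.i y ∧ C'.φ s'.j (s'.f v) = C'.φ s.j (s.f y)) ∧
      (∀ z, ∃ v, C'.φ s'.j (s'.f v) = C'.φ s.j z ∧
        ∀ g, z ∈ elemGrading (C'.γ s.j) g → v ∈ elemGrading (C.γ s'.i) g) := by
  obtain ⟨t, htj, hti, ht⟩ := s.exists_back h
  obtain ⟨s', hsj, hsi, hs⟩ := t.exists_back h.symm
  refine ⟨s', hti.trans_le hsj, htj.trans_lt hsi, fun y => ?_, fun z => ?_⟩
  · obtain ⟨z, hz, -⟩ := C'.exists_lift htj (s.f y)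
    obtain ⟨v, hv, -⟩ := C.exists_lift hsj (t.f z)
    exact ⟨v, hv.trans (ht y z hz.symm), (hs z v hv.symm).trans hz⟩
  · obtain ⟨w, hw, hwg⟩ := C'.exists_lift htj z
    obtain ⟨v, hv, hvg⟩ := C.exists_lift hsj (t.f w)
    exact ⟨v, (hs w v hv.symm).trans hw,
      fun g hz => hvg g (t.hasMult.isGradedHom g ⟨w, hwg g hz, rfl⟩)⟩

theorem Compat.isGradedAlgIso (h : Compat S x c b x' c' b') (C : MultChain F ℒ x c)
    (C' : MultChain F ℒ' x' c') : IsGradedAlgIso F ℒ ℒ' := by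
  obtain ⟨s₀⟩ := h.nonempty_link C C'
  choose nxt hi hj hy hz using fun s : Link C C' S b b' => s.exists_next h
  let s : ℕ → Link C C' S b b' := fun k => nxt^[k] s₀
  have hs : ∀ k, s (k + 1) = nxt (s k) := fun k => Function.iterate_succ_apply' _ _ _
  have hik : ∀ k, k ≤ (s k).i := by
    intro k
    induction k with
    | zero => exact Nat.zero_le _
    | succ k ih => rw [hs]; exact ih.trans_lt (hi _)
  have hjk : ∀ k, k ≤ (s k).j := by
    intro k
    induction k with
    | zero => exact Nat.zero_le _
    | succ k ih => rw [hs]; exact ih.trans_lt (hj _)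
  let ψ : ∀ s : Link C C' S b b', Matrix (Fin (C.n s.i)) (Fin (C.n s.i)) F →ₐ[F] L × L' :=
    fun s => (C.φ s.i).prod ((C'.φ s.j).comp s.f)
  have hmono : Monotone fun k => (ψ (s k)).range := by
    refine monotone_nat_of_le_succ fun k => ?_
    rintro _ ⟨y, rfl⟩
    obtain ⟨v, hv, hv'⟩ := hy (s k) y
    rw [hs]
    exact ⟨v, Prod.ext hv hv'⟩
  have hdir : Directed (· ≤ ·) fun k => (ψ (s k)).range := hmono.directed_le
  have hmem : ∀ {p}, p ∈ ⨆ k, (ψ (s k)).range ↔ ∃ k y, ψ (s k) y = p := by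
    intro p
    rw [← SetLike.mem_coe, Subalgebra.coe_iSup_of_directed hdir]
    simp
  have hinj : ∀ k, Function.Injective (s k).f := by
    intro k
    obtain ⟨t, htj, -, ht⟩ := (s k).exists_back h
    intro y y' hyy
    obtain ⟨z, hz, -⟩ := C'.exists_lift htj ((s k).f y)
    exact C.injective _ ((ht y z hz.symm).symm.trans (ht y' z (hyy ▸ hz.symm)))
  have lift₁ : ∀ i (y : Matrix (Fin (C.n i)) (Fin (C.n i)) F), ∃ v,
      (C.φ i y, v) ∈ ⨆ k, (ψ (s k)).range ∧
      ∀ g, y ∈ elemGrading (C.γ i) g → v ∈ ℒ' g := by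
    intro i y
    obtain ⟨y', hy', hg⟩ := C.exists_lift (hik i) y
    exact ⟨_, hmem.mpr ⟨i, y', Prod.ext hy' rfl⟩,
      fun g hyg => C'.map_mem ((s i).hasMult.isGradedHom g ⟨y', hg g hyg, rfl⟩)⟩
  have lift₂ : ∀ j (z : Matrix (Fin (C'.n j)) (Fin (C'.n j)) F), ∃ u,
      (u, C'.φ j z) ∈ ⨆ k, (ψ (s k)).range ∧
      ∀ g, z ∈ elemGrading (C'.γ j) g → u ∈ ℒ g := by
    intro j z
    obtain ⟨z', hz', hg⟩ := C'.exists_lift (hjk j) z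
    have hnext := hz (s j) z'
    rw [← hs] at hnext
    obtain ⟨v, hv, hvg⟩ := hnext
    exact ⟨_, hmem.mpr ⟨j + 1, v, Prod.ext rfl (hv.trans hz')⟩,
      fun g hzg => C.map_mem (hvg g (hg g hzg))⟩
  refine isGradedAlgIso_of_graph (⨆ k, (ψ (s k)).range) ?_ ?_ ?_ ?_ ?_ ?_
  · intro p hp hp1
    obtain ⟨k, y, rfl⟩ := hmem.mp hp
    have : y = 0 := C.injective _ (hp1.trans (map_zero _).symm)
    simp [this]
  · intro p hp hp2
    obtain ⟨k, y, rfl⟩ := hmem.mp hp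
    have : y = 0 := hinj k <| C'.injective _ (hp2.trans (by simp))
    simp [this]
  · intro u
    obtain ⟨i, y, rfl⟩ := C.exhausts u
    obtain ⟨v, hv, -⟩ := lift₁ i y
    exact ⟨v, hv⟩
  · intro v
    obtain ⟨j, z, rfl⟩ := C'.exhausts v
    obtain ⟨u, hu, -⟩ := lift₂ j z
    exact ⟨u, hu⟩
  · intro g u hu
    obtain ⟨i, y, hy, rfl⟩ := C.exists_of_mem hu
    obtain ⟨v, hv, hvg⟩ := lift₁ i y
    exact ⟨v, hvg g hy, hv⟩
  · intro g v hv
    obtain ⟨j, z, hz, rfl⟩ := C'.exists_of_mem hv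
    obtain ⟨u, hu, hug⟩ := lift₂ j z
    exact ⟨u, hug g hz, hu⟩

end Compatibility

section Stages

variable {F : Type} [Field F] {G : Type} [CommGroup G] [Fintype G] [DecidableEq G]
  {L : Type} [Ring L] [Algebra F L] {ℒ : G → Submodule F L}
  {L' : Type} [Ring L'] [Algebra F L'] {ℒ' : G → Submodule F L'}
  {L'' : Type} [Ring L''] [Algebra F L''] {ℒ'' : G → Submodule F L''}
  {x c x' c' x'' c'' : ℕ → Multiset G}
  {C : MultChain F ℒ x c} {C' : MultChain F ℒ' x' c'} {C'' : MultChain F ℒ'' x'' c''}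

/-- The map `e` carries stage `i` of the first chain into stage `j` of the second one, with
multiplicity `d`. -/
def StageMap {F : Type} [Field F] {G : Type} [CommGroup G] [DecidableEq G]
    {L : Type} [Ring L] [Algebra F L] {ℒ : G → Submodule F L}
    {L' : Type} [Ring L'] [Algebra F L'] {ℒ' : G → Submodule F L'} {x c x' c' : ℕ → Multiset G}
    (C : MultChain F ℒ x c) (C' : MultChain F ℒ' x' c') (e : L → L') (i j : ℕ)
    (d : Multiset G) : Prop :=
  ∃ f, HasMult (C.γ i) (C'.γ j) f d ∧ ∀ y, C'.φ j (f y) = e (C.φ i y)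

lemma StageMap.comp {e : L → L'} {e' : L' → L''} {i j k : ℕ} {d d' : Multiset G}
    (h' : StageMap C' C'' e' j k d') (h : StageMap C C' e i j d) :
    StageMap C C'' (e' ∘ e) i k (mmul d d') := by
  obtain ⟨f, hf, hfe⟩ := h
  obtain ⟨f', hf', hfe'⟩ := h'
  exact ⟨f'.comp f, hf'.comp hf, fun y => (hfe' _).trans (congrArg e' (hfe y))⟩

omit [Fintype G] in
lemma StageMap.unique {e : L → L'} {i j : ℕ} {d d' : Multiset G}
    (h : StageMap C C' e i j d) (h' : StageMap C C' e i j d') : d = d' := by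
  obtain ⟨f, hf, hfe⟩ := h
  obtain ⟨f', hf', hfe'⟩ := h'
  have := C.nonempty i
  obtain rfl : f = f' := AlgHom.ext fun y => C'.injective j ((hfe y).trans (hfe' y).symm)
  exact hf.unique hf'

lemma StageMap.eq_mmul {e : L → L'} {i j : ℕ} {d : Multiset G}
    (h : StageMap C C' e i j d) : x' j = mmul (x i) d := by
  obtain ⟨f, hf, -⟩ := h
  have := hf.eq_mmul
  rwa [C.reps, C'.reps] at this

lemma MultChain.exists_stageMap_id (C : MultChain F ℒ x c) {i j : ℕ} (hij : i ≤ j) :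
    ∃ p, StageMap C C id i j p ∧ ∀ χ, evBar χ p = ∏ l ∈ Finset.Ico i j, evBar χ (c l) := by
  obtain ⟨t, p, ht, htφ, hp⟩ := C.exists_transition hij
  exact ⟨p, ⟨t, ht, fun y => DFunLike.congr_fun htφ y⟩, hp⟩

/-- Going forth and back is the inclusion. -/
lemma StageMap.prod_of_leftInverse {e : L → L'} {e' : L' → L} (he : Function.LeftInverse e' e)
    {i j j' i' : ℕ} {d d' : Multiset G} (h : StageMap C C' e i j d)
    (h' : StageMap C' C e' j' i' d') (hi : i ≤ i') (hj : j ≤ j') (χ : G →* ℂˣ) :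
    evBar χ d * (∏ l ∈ Finset.Ico j j', evBar χ (c' l)) * evBar χ d' =
      ∏ l ∈ Finset.Ico i i', evBar χ (c l) := by
  obtain ⟨p, hp, hpχ⟩ := C.exists_stageMap_id hi
  obtain ⟨p', hp', hpχ'⟩ := C'.exists_stageMap_id hj
  have hcomp := h'.comp (hp'.comp h)
  rw [Function.id_comp, he.comp_eq_id] at hcomp
  rw [← hpχ, ← hcomp.unique hp, evBar_mmul, evBar_mmul, hpχ']

/-- The multiplicities are compatible with enlarging the stages. -/
lemma StageMap.prod_mul_comm {e : L → L'} {i j i' j' : ℕ} {d d' : Multiset G}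
    (h : StageMap C C' e i j d) (h' : StageMap C C' e i' j' d') (hi : i ≤ i') (hj : j ≤ j')
    (χ : G →* ℂˣ) :
    (∏ l ∈ Finset.Ico i i', evBar χ (c l)) * evBar χ d' =
      evBar χ d * ∏ l ∈ Finset.Ico j j', evBar χ (c' l) := by
  obtain ⟨p, hp, hpχ⟩ := C.exists_stageMap_id hi
  obtain ⟨p', hp', hpχ'⟩ := C'.exists_stageMap_id hj
  have h1 := h'.comp hp
  have h2 := hp'.comp h
  rw [Function.comp_id] at h1
  rw [Function.id_comp] at h2
  rw [← hpχ, ← hpχ', ← evBar_mmul, ← evBar_mmul, h1.unique h2]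

/-- A graded isomorphism carries each stage of one chain into arbitrarily late stages of
the other. -/
lemma exists_stageMap (C : MultChain F ℒ x c) (C' : MultChain F ℒ' x' c') (e : L ≃ₐ[F] L')
    (he : ∀ g, ∀ u ∈ ℒ g, e u ∈ ℒ' g) (i N : ℕ) : ∃ j d, N ≤ j ∧ StageMap C C' e i j d := by
  have hE : ∀ p : Fin (C.n i) × Fin (C.n i), ∃ j,
      ∃ w ∈ elemGrading (C'.γ j) (C.γ i p.1 * (C.γ i p.2)⁻¹),
        C'.φ j w = e (C.φ i (Matrix.single p.1 p.2 1)) :=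
    fun p => C'.exists_of_mem (he _ _ (C.map_mem (single_mem_elemGrading _ _ _)))
  choose J w hw hwe using hE
  obtain ⟨j, hNj, hJ⟩ : ∃ j, N ≤ j ∧ ∀ p, J p ≤ j :=
    ⟨max N (Finset.univ.sup J), le_max_left _ _,
      fun p => (Finset.le_sup (Finset.mem_univ p)).trans (le_max_right _ _)⟩
  choose y hy hyg using fun p => C'.exists_lift (hJ p) (w p)
  have hsum : ∀ X : Matrix (Fin (C.n i)) (Fin (C.n i)) F,
      C'.φ j (∑ p : Fin (C.n i) × Fin (C.n i), X p.1 p.2 • y p) = e (C.φ i X) := by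
    intro X
    conv_rhs => rw [Matrix.matrix_eq_sum_single X]
    simp only [map_sum, map_smul, hy, hwe, Fintype.sum_prod_type]
    refine Finset.sum_congr rfl fun p _ => Finset.sum_congr rfl fun q _ => ?_
    rw [← map_smul, ← map_smul, Matrix.smul_single, smul_eq_mul, mul_one]
  let f : Matrix (Fin (C.n i)) (Fin (C.n i)) F →ₐ[F] Matrix (Fin (C'.n j)) (Fin (C'.n j)) F :=
    ((AlgEquiv.ofInjective (C'.φ j) (C'.injective j)).symm : _ →ₐ[F] _).comp
      (((e : L →ₐ[F] L').comp (C.φ i)).codRestrict (C'.φ j).range fun X => ⟨_, hsum X⟩)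
  have hf : ∀ X, C'.φ j (f X) = e (C.φ i X) := fun X =>
    congrArg Subtype.val ((AlgEquiv.ofInjective (C'.φ j) (C'.injective j)).apply_symm_apply
      ⟨e (C.φ i X), ⟨_, hsum X⟩⟩)
  have := C.nonempty i
  obtain ⟨d, hd⟩ := IsGradedHom.exists_hasMult (φ := f) (γ := C.γ i) (δ := C'.γ j) (by
    rintro g _ ⟨X, hX, rfl⟩
    have hfX : f X = ∑ p : Fin (C.n i) × Fin (C.n i), X p.1 p.2 • y p :=
      C'.injective j ((hf X).trans (hsum X).symm)
    change f X ∈ _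
    rw [hfX]
    refine Submodule.sum_mem _ fun p _ => ?_
    by_cases h0 : X p.1 p.2 = 0
    · rw [h0, zero_smul]
      exact zero_mem _
    · have hg : C.γ i p.1 * (C.γ i p.2)⁻¹ = g := by
        rw [mem_elemGrading.mp hX _ _ h0, mul_inv_cancel_right]
      exact Submodule.smul_mem _ _ (hg ▸ hyg p _ (hw p)))
  exact ⟨j, d, hNj, f, hd, hf⟩

end Stages

section Necessity

variable {F : Type} [Field F] {G : Type} [CommGroup G] [Fintype G] [DecidableEq G]
  {L : Type} [Ring L] [Algebra F L] {ℒ : G → Submodule F L}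
  {L' : Type} [Ring L'] [Algebra F L'] {ℒ' : G → Submodule F L'}
  {x c x' c' : ℕ → Multiset G} {S S' : Set (G →* ℂˣ)}

lemma support_subset_of_equiv (C : MultChain F ℒ x c) (C' : MultChain F ℒ' x' c')
    (hS : ∀ i, suppM (c i) = S) (hS' : ∀ i, suppM (c' i) = S') (e : L ≃ₐ[F] L')
    (he : ∀ g, ∀ u ∈ ℒ g, e u ∈ ℒ' g) (he' : ∀ g, ∀ v ∈ ℒ' g, e.symm v ∈ ℒ g) : S' ⊆ S := by
  intro χ hχ
  obtain ⟨i, d₀, -, h₀⟩ := exists_stageMap C' C e.symm he' 0 0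
  obtain ⟨j, d₁, -, h₁⟩ := exists_stageMap C C' e he i 0
  obtain ⟨i', d₂, hi', h₂⟩ := exists_stageMap C' C e.symm he' j (i + 1)
  obtain ⟨j', d₃, hj', h₃⟩ := exists_stageMap C C' e he i' j
  have h12 := h₁.prod_of_leftInverse e.symm_apply_apply h₂ (by omega) le_rfl χ
  have h01 := h₀.prod_of_leftInverse e.apply_symm_apply h₁ (Nat.zero_le _) le_rfl χ
  have h23 := h₂.prod_of_leftInverse e.apply_symm_apply h₃ hj' le_rfl χ
  by_contra hχS
  rw [prod_Ico_evBar_eq_zero hS hχS hi'] at h12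
  have n01 := prod_Ico_evBar_ne_zero hS' hχ 0 j
  have n23 := prod_Ico_evBar_ne_zero hS' hχ j j'
  rw [← h01] at n01
  rw [← h23] at n23
  simp only [Finset.Ico_self, Finset.prod_empty, mul_one] at h12 n01 n23
  exact mul_ne_zero (right_ne_zero_of_mul n01) (left_ne_zero_of_mul n23) h12

theorem exists_compat_of_equiv (C : MultChain F ℒ x c) (C' : MultChain F ℒ' x' c')
    (hS : ∀ i, suppM (c i) = S) (hS' : ∀ i, suppM (c' i) = S)
    (hx : suppM (x 0) ⊆ S) (hx' : suppM (x' 0) ⊆ S) (e : L ≃ₐ[F] L')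
    (he : ∀ g, ∀ u ∈ ℒ g, e u ∈ ℒ' g) (he' : ∀ g, ∀ v ∈ ℒ' g, e.symm v ∈ ℒ g) :
    ∃ b b', Compat S x c b x' c' b' := by
  obtain ⟨j, d, -, h⟩ := exists_stageMap C C' e he 0 0
  have hd : ∀ χ ∈ S, evBar χ d ≠ 0 := by
    intro χ hχ
    obtain ⟨i, d₁, -, h₁⟩ := exists_stageMap C' C e.symm he' j 0
    have h01 := h.prod_of_leftInverse e.symm_apply_apply h₁ (Nat.zero_le _) le_rfl χ
    have n01 := prod_Ico_evBar_ne_zero hS hχ 0 i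
    rw [← h01] at n01
    exact left_ne_zero_of_mul (left_ne_zero_of_mul n01)
  have hb : ∀ χ, evChar χ (mmul (mbarM d) (mbarM (c' 0))) = evBar χ d * evBar χ (c' 0) :=
    fun χ => evChar_mmul _ _ _
  have hb' : ∀ χ, evChar χ (mmul (bprod c' j) (mbarM (c' 0))) =
      evChar χ (bprod c' j) * evBar χ (c' 0) := fun χ => evChar_mmul _ _ _
  have hc0 : ∀ χ, evBar χ (c' 0) ≠ 0 ↔ χ ∈ S := fun χ => by rw [evBar_ne_zero_iff, hS']
  refine ⟨mmul (mbarM d) (mbarM (c' 0)), mmul (bprod c' j) (mbarM (c' 0)),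
    hS, hS', hx, hx', ?_, ?_, ?_, ?_⟩
  · ext χ
    change evChar χ _ ≠ 0 ↔ _
    rw [hb]
    exact ⟨fun h0 => (hc0 χ).mp (right_ne_zero_of_mul h0),
      fun hχ => mul_ne_zero (hd χ hχ) ((hc0 χ).mpr hχ)⟩
  · ext χ
    change evChar χ _ ≠ 0 ↔ _
    rw [hb']
    exact ⟨fun h0 => (hc0 χ).mp (right_ne_zero_of_mul h0),
      fun hχ => mul_ne_zero (evChar_bprod_ne_zero hS' hχ j) ((hc0 χ).mpr hχ)⟩
  · refine multiset_eq_of_evChar_eq fun χ => ?_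
    rw [evChar_mmul, hb, evChar_mmul _ (mmul (bprod c' j) _), hb']
    change _ * evBar χ (x 0) = _ * evBar χ (x' 0)
    have h1 := C'.evBar_x χ j
    rw [h.eq_mmul, evBar_mmul] at h1
    linear_combination evBar χ (c' 0) * h1
  · refine subset_antisymm ?_ ?_
    · rintro _ ⟨f, ⟨i, z, hf⟩, rfl⟩
      obtain ⟨j', d', hj', h'⟩ := exists_stageMap C C' e he i j
      refine ⟨_, ⟨j', mmul z (mbarM d'), fun χ => rfl⟩, ?_⟩
      funext χ
      simp only [hf, hb, hb', evChar_mmul]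
      split_ifs with hχ
      · have h1 := h.prod_mul_comm h' (Nat.zero_le i) hj' χ
        have h2 := evChar_bprod_mul_prod_Ico χ c' hj'
        have h3 := evChar_bprod_mul_prod_Ico χ c (Nat.zero_le i)
        have n1 := evChar_bprod_ne_zero hS hχ i
        have n2 := evChar_bprod_ne_zero hS' hχ j'
        simp only [bprod, evChar_one_singleton, one_mul] at h3
        rw [h3] at h1
        change _ * (_ * evBar χ d' / _) = _
        rw [← mul_div_assoc, ← mul_div_assoc, div_eq_div_iff n2 n1, ← h2]
        linear_combination evChar χ z * evChar χ (bprod c' j) * evBar χ (c' 0) * h1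
      · simp
    · rintro _ ⟨f, ⟨l, z, hf⟩, rfl⟩
      obtain ⟨i, d', -, h'⟩ := exists_stageMap C' C e.symm he' (max l j) 0
      obtain ⟨-, p, -, -, hp⟩ := C'.exists_transition (le_max_left l j)
      refine ⟨_, ⟨i, mmul (mmul z (mbarM p)) (mbarM d'), fun χ => rfl⟩, ?_⟩
      funext χ
      simp only [hf, hb, hb', evChar_mmul]
      split_ifs with hχ
      · have h1 := h.prod_of_leftInverse e.symm_apply_apply h' (Nat.zero_le i)
          (le_max_right l j) χ
        have h2 := evChar_bprod_mul_prod_Ico χ c' (le_max_right l j)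
        have h3 := evChar_bprod_mul_prod_Ico χ c (Nat.zero_le i)
        have h4 := evChar_bprod_mul_prod_Ico χ c' (le_max_left l j)
        have n1 := evChar_bprod_ne_zero hS hχ i
        have n2 := evChar_bprod_ne_zero hS' hχ l
        simp only [bprod, evChar_one_singleton, one_mul] at h3
        rw [h3] at h1
        change _ * (_ * evBar χ p * evBar χ d' / _) = _
        rw [hp, ← mul_div_assoc, ← mul_div_assoc, div_eq_div_iff n1 n2]
        linear_combination evBar χ (c' 0) * evChar χ z * (evBar χ d * evBar χ d' * (h4 - h2) +
          evChar χ (bprod c' j) * h1)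
      · simp

end Necessity

section TrivialLimit

variable {F : Type} [Field F] {G : Type} [CommGroup G]
  {L : Type} [Ring L] [Algebra F L] {ℒ : G → Submodule F L}
  {L' : Type} [Ring L'] [Algebra F L'] {ℒ' : G → Submodule F L'}

lemma IsGradedAlgIso.symm (h : IsGradedAlgIso F ℒ ℒ') : IsGradedAlgIso F ℒ' ℒ := by
  obtain ⟨e, he⟩ := h
  refine ⟨e.symm, fun g => ?_⟩
  rw [← he g]
  ext u
  simp

lemma isGradedAlgIso_of_subsingleton [Subsingleton L] [Subsingleton L'] :
    IsGradedAlgIso F ℒ ℒ' :=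
  ⟨{ toFun := 0, invFun := 0, left_inv := fun _ => Subsingleton.elim _ _,
     right_inv := fun _ => Subsingleton.elim _ _, map_mul' := fun _ _ => Subsingleton.elim _ _,
     map_add' := fun _ _ => Subsingleton.elim _ _,
     commutes' := fun _ => Subsingleton.elim _ _ }, fun _ => Subsingleton.elim _ _⟩

lemma suppM_zero : suppM (0 : Multiset G) = ∅ := by
  simp [suppM, evChar]

lemma iso_iff_of_initial_eq_zero [Fintype G] [DecidableEq G] {x a x' a' : ℕ → Multiset G}
    {S S' : Set (G →* ℂˣ)}
    (hlim : IsElemLimit F L ℒ x a) (hlim' : IsElemLimit F L' ℒ' x' a')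
    (hstS : ∀ i, suppM (a i) = S) (hstS' : ∀ i, suppM (a' i) = S')
    (hstx' : suppM (x' 0) ⊆ S') (hx : x 0 = 0) :
    IsGradedAlgIso F ℒ ℒ' ↔
      (S = S' ∧ ∃ b b' : Multiset G, suppM b = S ∧ suppM b' = S ∧
        mmul b (mbarM (x 0)) = mmul b' (mbarM (x' 0)) ∧
        mscale b (Kplus S a) = mscale b' (Kplus S' a')) := by
  have hL : Subsingleton L := hlim.subsingleton_iff.mpr hx
  have hS : S = ∅ := by rw [← hstS 0, hlim.label_eq_zero, suppM_zero]
  constructor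
  · rintro ⟨e, -⟩
    have hL' : Subsingleton L' := e.symm.injective.subsingleton
    have hS' : S' = ∅ := by rw [← hstS' 0, hlim'.label_eq_zero, suppM_zero]
    subst hS hS'
    refine ⟨rfl, 0, 0, suppM_zero, suppM_zero, rfl, congrArg _ ?_⟩
    simp [Kplus]
  · rintro ⟨rfl, -⟩
    have hL' : Subsingleton L' :=
      hlim'.subsingleton_iff.mpr (suppM_eq_empty (Set.subset_empty_iff.mp (hS ▸ hstx')))
    exact isGradedAlgIso_of_subsingleton

end TrivialLimit

/-- (Isomorphism criterion.) Let `A = M_{x 0} ⊗ ⊗_i M_{a i}` and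
`A' = M_{x' 0} ⊗ ⊗_i M_{a' i}` be direct limits of elementarily `G`-graded matrix algebras
in standard form with supports `S` and `S'`. Then `A ≅ A'` as `G`-graded algebras iff
`S = S'` and there are `b, b' ∈ ℤ≥0 G` supported on `S` with `b \bar x_0 = b' \bar x'_0`
and `b K⁺(A) = b' K⁺(A')`. -/
theorem elemLimit_iso_iff
    {F : Type} [Field F] {G : Type} [CommGroup G] [Fintype G] [DecidableEq G]
    {L : Type} [Ring L] [Algebra F L] (ℒ : G → Submodule F L)
    {L' : Type} [Ring L'] [Algebra F L'] (ℒ' : G → Submodule F L')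
    (x a x' a' : ℕ → Multiset G) (S S' : Set (G →* ℂˣ))
    (hlim : IsElemLimit F L ℒ x a) (hlim' : IsElemLimit F L' ℒ' x' a')
    (hstS : ∀ i, suppM (a i) = S) (hstx : suppM (x 0) ⊆ S)
    (hstS' : ∀ i, suppM (a' i) = S') (hstx' : suppM (x' 0) ⊆ S') :
    IsGradedAlgIso F ℒ ℒ' ↔
      (S = S' ∧ ∃ b b' : Multiset G, suppM b = S ∧ suppM b' = S ∧
        mmul b (mbarM (x 0)) = mmul b' (mbarM (x' 0)) ∧
        mscale b (Kplus S a) = mscale b' (Kplus S' a')) := by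
  by_cases hx : x 0 = 0
  · exact iso_iff_of_initial_eq_zero hlim hlim' hstS hstS' hstx' hx
  by_cases hx' : x' 0 = 0
  · refine Iff.trans ⟨IsGradedAlgIso.symm, IsGradedAlgIso.symm⟩
      ((iso_iff_of_initial_eq_zero hlim' hlim hstS' hstS hstx hx').trans ?_)
    constructor
    · rintro ⟨rfl, b, b', hb, hb', h, hK⟩
      exact ⟨rfl, b', b, hb', hb, h.symm, hK.symm⟩
    · rintro ⟨rfl, b, b', hb, hb', h, hK⟩
      exact ⟨rfl, b', b, hb', hb, h.symm, hK.symm⟩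
  obtain ⟨c, g, hc, ⟨C⟩⟩ := hlim.exists_multChain hx
  obtain ⟨c', g', hc', ⟨C'⟩⟩ := hlim'.exists_multChain hx'
  have hcS : ∀ i, suppM (c i) = S := fun i => by rw [hc, suppM_shift, hstS]
  have hcS' : ∀ i, suppM (c' i) = S' := fun i => by rw [hc', suppM_shift, hstS']
  rw [← Kplus_shift hc, ← Kplus_shift hc']
  constructor
  · rintro ⟨e, he⟩
    have h₁ : ∀ g, ∀ u ∈ ℒ g, e u ∈ ℒ' g := fun g u hu => he g ▸ ⟨u, hu, rfl⟩
    have h₂ : ∀ g, ∀ v ∈ ℒ' g, e.symm v ∈ ℒ g := by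
      intro g v hv
      rw [← he g] at hv
      obtain ⟨u, hu, rfl⟩ := hv
      simpa using hu
    obtain rfl : S = S' := subset_antisymm
      (support_subset_of_equiv C' C hcS' hcS e.symm h₂ h₁)
      (support_subset_of_equiv C C' hcS hcS' e h₁ h₂)
    obtain ⟨b, b', h⟩ := exists_compat_of_equiv C C' hcS hcS' hstx hstx' e h₁ h₂
    exact ⟨rfl, b, b', h.supp, h.supp', h.init, h.cone⟩
  · rintro ⟨rfl, b, b', hb, hb', h, hK⟩
    exact Compat.isGradedAlgIso ⟨hcS, hcS', hstx, hstx', hb, hb', h, hK⟩ C C'
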